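/- arXiv:2204.03677 — 4 statements merged into one kernel-verified Lean document; each statement's English description precedes it below -/
import Mathlib

section
/- Let F : ℂ → ℂ be analytic on all of ℂ, and let n ≥ 1 and m ≥ 0 be integers. Then the following are equivalent. (a) F(s) = F(−s) for every s ∈ {1, 2, …, n} ∪ {n+2, n+4, …, n+2m}. (b) There exist functions G₁, …, G_n : ℂ → ℂ, analytic on all of ℂ, such that F(k+1) − F(k−1) = k·G₁(k) for all k ∈ ℂ and G_q(k+1) − G_q(k−1) = k·G_{q+1}(k) for all k ∈ ℂ and all 1 ≤ q ≤ n−1, and, if m ≥ 1, there additionally exist functions H₁, …, H_m : ℂ → ℂ, analytic on all of ℂ, such that G_n(k+2) − G_n(k−2) = k·H₁(k) for all k ∈ ℂ and H_t(k+2) − H_t(k−2) = k·H_{t+1}(k) for all k ∈ ℂ and all 1 ≤ t ≤ m−1. -/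
/-- The symmetry conditions on `f`. -/
def CC (n m : ℕ) (f : ℂ → ℂ) : Prop :=
  ∀ s : ℕ, ((1 ≤ s ∧ s ≤ n) ∨ (∃ t : ℕ, 1 ≤ t ∧ t ≤ m ∧ s = n + 2 * t)) →
      f (s : ℂ) = f (-(s : ℂ))

/-- `g` is the quotient of the `c`-difference of `f`. -/
def DRel (c : ℂ) (f g : ℂ → ℂ) : Prop := ∀ k : ℂ, f (k + c) - f (k - c) = k * g k

/-- Explicit analytic quotient. -/
noncomputable def QQ (c : ℂ) (f : ℂ → ℂ) : ℂ → ℂ :=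
  dslope (fun k => f (k + c) - f (k - c)) 0

lemma QQ_analytic (c : ℂ) (f : ℂ → ℂ) (hf : ∀ z, AnalyticAt ℂ f z) (z : ℂ) :
    AnalyticAt ℂ (QQ c f) z := by
  have hd : Differentiable ℂ f := fun z => (hf z).differentiableAt
  have hg : Differentiable ℂ (fun k => f (k + c) - f (k - c)) := by fun_prop
  have : DifferentiableOn ℂ (QQ c f) Set.univ :=
    (Complex.differentiableOn_dslope Filter.univ_mem).2 hg.differentiableOn
  exact this.analyticAt Filter.univ_mem

lemma QQ_rel (c : ℂ) (f : ℂ → ℂ) (h : f c = f (-c)) : DRel c f (QQ c f) := by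
  intro k
  have := sub_smul_dslope (fun k => f (k + c) - f (k - c)) 0 k
  simp only [sub_zero, zero_add, zero_sub, smul_eq_mul, h, sub_self] at this
  exact this.symm

lemma rel_zero {c : ℂ} {f g : ℂ → ℂ} (h : DRel c f g) : f c = f (-c) := by
  have := h 0
  simp only [zero_add, zero_sub, zero_mul] at this
  exact sub_eq_zero.1 this

lemma rel_odd {c : ℂ} {f g : ℂ → ℂ} (h : DRel c f g) (s : ℂ) :
    s * (g s - g (-s)) = (f (s + c) - f (-(s + c))) - (f (s - c) - f (-(s - c))) := by
  have h1 := h s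
  have h2 := h (-s)
  rw [show -s + c = -(s - c) by ring, show -s - c = -(s + c) by ring] at h2
  linear_combination -h1 - h2

/-- Step for an integer shift, in natural-number form. -/
lemma rel_nat {c : ℕ} {f g : ℂ → ℂ} (h : DRel c f g) (r : ℕ) :
    ((r + c : ℕ) : ℂ) * (g ((r + c : ℕ) : ℂ) - g (-((r + c : ℕ) : ℂ))) =
      (f ((r + c + c : ℕ) : ℂ) - f (-((r + c + c : ℕ) : ℂ))) - (f (r : ℂ) - f (-(r : ℂ))) := by
  have := rel_odd h ((r + c : ℕ) : ℂ)
  rw [this]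
  push_cast
  simp only [add_sub_cancel_right]

lemma sym_down {c : ℕ} {f g : ℂ → ℂ} (h : DRel c f g) (r : ℕ) (hc : r + c ≠ 0)
    (h1 : f ((r + c + c : ℕ) : ℂ) = f (-((r + c + c : ℕ) : ℂ)))
    (h2 : f (r : ℂ) = f (-(r : ℂ))) : g ((r + c : ℕ) : ℂ) = g (-((r + c : ℕ) : ℂ)) := by
  have := rel_nat h r
  rw [← h1, ← h2, sub_self, sub_self, sub_self] at this
  have h3 : ((r + c : ℕ) : ℂ) ≠ 0 := by exact_mod_cast hc
  exact sub_eq_zero.1 ((mul_eq_zero.1 this).resolve_left h3)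

lemma sym_up {c : ℕ} {f g : ℂ → ℂ} (h : DRel c f g) (r : ℕ)
    (h1 : g ((r + c : ℕ) : ℂ) = g (-((r + c : ℕ) : ℂ)))
    (h2 : f (r : ℂ) = f (-(r : ℂ))) :
    f ((r + c + c : ℕ) : ℂ) = f (-((r + c + c : ℕ) : ℂ)) := by
  have := rel_nat h r
  rw [← h1, ← h2, sub_self, sub_self, sub_zero, mul_zero] at this
  exact sub_eq_zero.1 this.symm

lemma sym_zero (f : ℂ → ℂ) : f ((0 : ℕ) : ℂ) = f (-((0 : ℕ) : ℂ)) := by simp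

lemma step1 {n m : ℕ} {f g : ℂ → ℂ} (h : DRel 1 f g) : CC (n + 1) m f ↔ CC n m g := by
  have h' : DRel ((1 : ℕ) : ℂ) f g := by simpa using h
  constructor
  · intro hf s hs
    obtain ⟨r, rfl⟩ : ∃ r, s = r + 1 := ⟨s - 1, by grind⟩
    refine sym_down h' r (by omega) (hf _ ?_) ?_
    · rcases hs with hs | ⟨t, ht, htm, hs⟩
      · left; omega
      · right; exact ⟨t, ht, htm, by omega⟩
    · rcases Nat.eq_zero_or_pos r with rfl | hr
      · exact sym_zero f
      · refine hf _ ?_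
        rcases hs with hs | ⟨t, ht, htm, hs⟩
        · left; omega
        · by_cases h1 : t = 1
          · left; omega
          · right; exact ⟨t - 1, by omega, by omega, by omega⟩
  · intro hg s
    induction s using Nat.strong_induction_on with
    | _ s ih =>
      intro hs
      by_cases h1 : s = 1
      · subst h1; exact rel_zero h'
      · obtain ⟨r, rfl⟩ : ∃ r, s = r + 1 + 1 := ⟨s - 2, by grind⟩
        refine sym_up h' r (hg _ ?_) ?_
        · rcases hs with hs | ⟨t, ht, htm, hs⟩
          · left; omega
          · right; exact ⟨t, ht, htm, by omega⟩
        · rcases Nat.eq_zero_or_pos r with rfl | hr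
          · exact sym_zero f
          · refine ih _ (by omega) ?_
            rcases hs with hs | ⟨t, ht, htm, hs⟩
            · left; omega
            · by_cases h1 : t = 1
              · left; omega
              · right; exact ⟨t - 1, by omega, by omega, by omega⟩

lemma step2 {m : ℕ} {f g : ℂ → ℂ} (h : DRel 2 f g) : CC 0 (m + 1) f ↔ CC 0 m g := by
  have h' : DRel ((2 : ℕ) : ℂ) f g := by simpa using h
  constructor
  · intro hf s hs
    obtain ⟨t, ht, htm, hs⟩ := hs.resolve_left (by omega)
    obtain ⟨r, rfl⟩ : ∃ r, s = r + 2 := ⟨s - 2, by omega⟩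
    refine sym_down h' r (by omega) (hf _ (Or.inr ⟨t + 1, by omega, by omega, by omega⟩)) ?_
    rcases Nat.eq_zero_or_pos r with rfl | hr
    · exact sym_zero f
    · exact hf _ (Or.inr ⟨t - 1, by omega, by omega, by omega⟩)
  · intro hg s
    induction s using Nat.strong_induction_on with
    | _ s ih =>
      intro hs
      obtain ⟨t, ht, htm, hs⟩ := hs.resolve_left (by omega)
      by_cases h1 : s = 2
      · subst h1; exact rel_zero h'
      · obtain ⟨r, rfl⟩ : ∃ r, s = r + 2 + 2 := ⟨s - 4, by omega⟩
        refine sym_up h' r (hg _ (Or.inr ⟨t - 1, by omega, by omega, by omega⟩)) ?_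
        rcases Nat.eq_zero_or_pos r with rfl | hr
        · exact sym_zero f
        · exact ih _ (by omega) (Or.inr ⟨t - 2, by omega, by omega, by omega⟩)

lemma chain1 {n m : ℕ} : ∀ {G : ℕ → ℂ → ℂ}, (∀ q < n, DRel 1 (G q) (G (q + 1))) →
    (CC n m (G 0) ↔ CC 0 m (G n)) := by
  induction n with
  | zero => intro G _; rfl
  | succ n ih =>
    intro G h
    rw [step1 (h 0 (by omega))]
    exact ih (G := fun q => G (q + 1)) (fun q hq => h (q + 1) (by omega))

lemma chain2 {m : ℕ} : ∀ {G : ℕ → ℂ → ℂ}, (∀ q < m, DRel 2 (G q) (G (q + 1))) →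
    CC 0 m (G 0) := by
  induction m with
  | zero => intro G _ s hs; grind
  | succ m ih =>
    intro G h
    rw [step2 (h 0 (by omega))]
    exact ih (G := fun q => G (q + 1)) (fun q hq => h (q + 1) (by omega))

lemma iter_analytic (c : ℂ) (q : ℕ) : ∀ (f : ℂ → ℂ), (∀ z, AnalyticAt ℂ f z) →
    ∀ z, AnalyticAt ℂ ((QQ c)^[q] f) z := by
  induction q with
  | zero => intro f hf; exact hf
  | succ q ih => intro f hf; exact ih _ (QQ_analytic c f hf)

lemma exist1 {n m : ℕ} : ∀ {f : ℂ → ℂ}, CC n m f →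
    ∀ q < n, DRel 1 ((QQ 1)^[q] f) ((QQ 1)^[q + 1] f) := by
  induction n with
  | zero => intro f _ q hq; omega
  | succ n ih =>
    intro f hf q hq
    have h0 : DRel 1 f (QQ 1 f) := QQ_rel 1 f (by simpa using hf 1 (Or.inl ⟨le_rfl, by omega⟩))
    cases q with
    | zero => exact h0
    | succ q => exact ih ((step1 h0).1 hf) q (by omega)

lemma exist2 {m : ℕ} : ∀ {f : ℂ → ℂ}, CC 0 m f →
    ∀ q < m, DRel 2 ((QQ 2)^[q] f) ((QQ 2)^[q + 1] f) := by
  induction m with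
  | zero => intro f _ q hq; omega
  | succ n ih =>
    intro f hf q hq
    have h0 : DRel 2 f (QQ 2 f) := QQ_rel 2 f
      (by simpa using hf 2 (Or.inr ⟨1, le_rfl, by omega, by omega⟩))
    cases q with
    | zero => exact h0
    | succ q => exact ih ((step2 h0).1 hf) q (by omega)

/-- One-dimensional characterisation of the quasi-invariance
conditions of Baker–Akhiezer functions (Lemma on analytic quotients of the
difference operators `δ` and `δ₂`). -/
theorem stmt_0 (F : ℂ → ℂ) (hF : ∀ z : ℂ, AnalyticAt ℂ F z)
    (n m : ℕ) (hn : 1 ≤ n) :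
    (∀ s : ℕ, ((1 ≤ s ∧ s ≤ n) ∨ (∃ t : ℕ, 1 ≤ t ∧ t ≤ m ∧ s = n + 2 * t)) →
      F (s : ℂ) = F (-(s : ℂ)))
    ↔
    (∃ G : ℕ → ℂ → ℂ,
      (∀ q : ℕ, 1 ≤ q → q ≤ n → ∀ z : ℂ, AnalyticAt ℂ (G q) z) ∧
      (∀ k : ℂ, F (k + 1) - F (k - 1) = k * G 1 k) ∧
      (∀ q : ℕ, 1 ≤ q → q ≤ n - 1 →
        ∀ k : ℂ, G q (k + 1) - G q (k - 1) = k * G (q + 1) k) ∧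
      (1 ≤ m →
        ∃ H : ℕ → ℂ → ℂ,
          (∀ t : ℕ, 1 ≤ t → t ≤ m → ∀ z : ℂ, AnalyticAt ℂ (H t) z) ∧
          (∀ k : ℂ, G n (k + 2) - G n (k - 2) = k * H 1 k) ∧
          (∀ t : ℕ, 1 ≤ t → t ≤ m - 1 →
            ∀ k : ℂ, H t (k + 2) - H t (k - 2) = k * H (t + 1) k))) := by
  constructor
  · intro h
    have hC : CC n m F := h
    have hR := exist1 hC
    have hA := iter_analytic 1
    have hE : CC 0 m ((QQ 1)^[n] F) := (chain1 (G := fun q => (QQ 1)^[q] F) hR).1 hC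
    refine ⟨fun q => (QQ 1)^[q] F, fun q _ _ => hA q F hF, hR 0 (by omega),
      fun q _ hq => hR q (by omega), fun hm => ?_⟩
    have hR2 := exist2 hE
    exact ⟨fun q => (QQ 2)^[q] ((QQ 1)^[n] F),
      fun q _ _ => iter_analytic 2 q _ (hA n F hF), hR2 0 (by omega),
      fun q _ hq => hR2 q (by omega)⟩
  · rintro ⟨G, -, hG1, hG, hH⟩
    have key : CC 0 m (G n) := by
      rcases Nat.eq_zero_or_pos m with rfl | hm
      · intro s hs; grind
      · obtain ⟨H, -, hH1, hH2⟩ := hH hm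
        refine chain2 (G := fun q => if q = 0 then G n else H q) (fun q hq => ?_)
        rcases Nat.eq_zero_or_pos q with rfl | hq0
        · simpa [DRel] using hH1
        · simpa [DRel, hq0.ne'] using hH2 q hq0 (by omega)
    have := (chain1 (n := n) (m := m) (G := fun q => if q = 0 then F else G q) (fun q hq => by
      rcases Nat.eq_zero_or_pos q with rfl | hq0
      · simpa [DRel] using hG1
      · simpa [DRel, hq0.ne'] using hG q hq0 (by omega))).2
    have hn0 : n ≠ 0 := by omega
    simp only [hn0, if_false, if_true] at this
    exact this key
end

section
/- Let n ≥ 1, let α ∈ ℂⁿ with ⟨α,α⟩ ≠ 0, and let m_α ≥ 1 and m_{2α} ≥ 0 be integers. Let ψ : ℂⁿ → ℂ be analytic on all of ℂⁿ. Then the following are equivalent. (a) For every s ∈ {1, …, m_α} ∪ {m_α+2, m_α+4, …, m_α+2m_{2α}}, ψ(z+sα) = ψ(z−sα) for every z ∈ ℂⁿ with ⟨α,z⟩ = 0. (b) There exist functions G₁, …, G_{m_α} : ℂⁿ → ℂ, analytic on all of ℂⁿ, such that ψ(z+α) − ψ(z−α) = ⟨z,α⟩·G₁(z) for all z and G_q(z+α)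 − G_q(z−α) = ⟨z,α⟩·G_{q+1}(z) for all z and all 1 ≤ q ≤ m_α−1, and, if m_{2α} ≥ 1, there additionally exist functions H₁, …, H_{m_{2α}} : ℂⁿ → ℂ, analytic on all of ℂⁿ, such that G_{m_α}(z+2α) − G_{m_α}(z−2α) = ⟨z,α⟩·H₁(z) for all z and H_t(z+2α) − H_t(z−2α) = ⟨z,α⟩·H_{t+1}(z) for all z and all 1 ≤ t ≤ m_{2α}−1. -/
/-- The bilinear extension of the Euclidean inner product on `ℂⁿ`. -/
noncomputable def bil {n : ℕ} (z w : Fin n → ℂ) : ℂ := ∑ i, z i * w i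

open scoped NNReal ENNReal in
lemma analytic_integral_aux {E : Type*} [NormedAddCommGroup E] [NormedSpace ℂ E]
    (k : E → ℂ) (T : ℝ → E →L[ℂ] E) (hT : Continuous T) (C : ℝ≥0) (hC : 0 < C)
    (hTC : ∀ t ∈ Set.uIoc (0 : ℝ) 1, ‖T t‖ ≤ C) (p : E) (hk : AnalyticAt ℂ k p) :
    AnalyticAt ℂ (fun y => ∫ t in (0 : ℝ)..1, k (p + T t y)) 0 := by
  obtain ⟨P, r, hP⟩ := hk
  obtain ⟨r', hr'0, hr'⟩ := ENNReal.lt_iff_exists_nnreal_btwn.1 hP.r_pos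
  have hr'pos : 0 < r' := by exact_mod_cast hr'0
  obtain ⟨B, hB, hPB⟩ := P.norm_mul_pow_le_of_lt_radius (hr'.trans_le hP.r_le)
  have hcont : ∀ n, Continuous fun t : ℝ => (P n).compContinuousLinearMap (fun _ => T t) := by
    intro n
    have h1 := (ContinuousMultilinearMap.compContinuousLinearMapContinuousMultilinear ℂ
      (fun _ : Fin n => E) (fun _ : Fin n => E) ℂ).cont
    have h2 : Continuous fun t : ℝ => (fun _ : Fin n => T t) := by fun_prop
    exact (h1.comp h2).clm_apply (continuous_const (y := P n))
  have hnorm : ∀ n, ∀ t ∈ Set.uIoc (0 : ℝ) 1,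
      ‖(P n).compContinuousLinearMap (fun _ => T t)‖ ≤ ‖P n‖ * C ^ n := by
    intro n t ht
    refine (ContinuousMultilinearMap.norm_compContinuousLinearMap_le _ _).trans ?_
    simp only [Finset.prod_const, Finset.card_univ, Fintype.card_fin]
    gcongr
    exact hTC t ht
  refine ⟨fun n => ∫ t in (0 : ℝ)..1, (P n).compContinuousLinearMap (fun _ => T t),
    ((r' / C : ℝ≥0) : ℝ≥0∞), ?_, ?_, ?_⟩
  · refine FormalMultilinearSeries.le_radius_of_bound _ B fun n => ?_
    have h := intervalIntegral.norm_integral_le_of_norm_le_const (hnorm n)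
    refine le_trans (mul_le_mul_of_nonneg_right h (by positivity)) ?_
    refine le_trans (le_of_eq ?_) (hPB n)
    have : (C : ℝ) ≠ 0 := by exact_mod_cast hC.ne'
    push_cast
    rw [div_pow]
    field_simp
    simp
  · have : 0 < r' / C := by positivity
    exact_mod_cast this
  · intro y hy
    have hy' : ‖y‖ < r' / C := by
      rw [Metric.mem_eball, edist_zero_right, enorm_eq_nnnorm] at hy
      have : ‖y‖₊ < r' / C := by exact_mod_cast hy
      exact_mod_cast this
    have hCy : C * ‖y‖ < r' := by
      rw [lt_div_iff₀ (by exact_mod_cast hC)] at hy'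
      linarith
    have hb : ∀ n, ‖P n‖ * (C * ‖y‖) ^ n ≤ B * ((C * ‖y‖) / r') ^ n := by
      intro n
      have h0 : (0 : ℝ) < r' := by exact_mod_cast hr'pos
      calc ‖P n‖ * (C * ‖y‖) ^ n = (‖P n‖ * r' ^ n) * ((C * ‖y‖) / r') ^ n := by
            rw [div_pow]; field_simp
        _ ≤ _ := by gcongr; exact hPB n
    have hsum : Summable fun n => B * ((C * ‖y‖) / r') ^ n := by
      apply Summable.mul_left
      apply summable_geometric_of_lt_one (by positivity)
      rw [div_lt_one (by exact_mod_cast hr'pos)]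
      exact hCy
    have key : HasSum (fun n => ∫ t in (0 : ℝ)..1, (P n) (fun _ => T t y))
        (∫ t in (0 : ℝ)..1, k (p + T t y)) := by
      refine intervalIntegral.hasSum_integral_of_dominated_convergence
        (fun n _ => B * ((C * ‖y‖) / r') ^ n) ?_ ?_ ?_ ?_ ?_
      · intro n
        apply Continuous.aestronglyMeasurable
        have h2 : Continuous fun t : ℝ => (fun _ : Fin n => T t y) := by fun_prop
        exact (P n).cont.comp h2
      · intro n
        refine Filter.Eventually.of_forall fun t ht => ?_
        refine le_trans ?_ (hb n)
        refine ((P n).le_opNorm _).trans ?_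
        simp only [Finset.prod_const, Finset.card_univ, Fintype.card_fin]
        gcongr
        exact (T t).le_of_opNorm_le (hTC t ht) y
      · exact Filter.Eventually.of_forall fun t ht => hsum
      · exact intervalIntegrable_const
      · refine Filter.Eventually.of_forall fun t ht => ?_
        apply hP.hasSum
        rw [Metric.mem_eball, edist_zero_right, enorm_eq_nnnorm]
        refine lt_trans ?_ hr'
        have : ‖T t y‖ < r' := ((T t).le_of_opNorm_le (hTC t ht) y).trans_lt hCy
        exact_mod_cast this
    rw [zero_add]
    refine (congrArg (fun F => HasSum F _) (funext fun n => ?_)).mpr key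
    have := (ContinuousMultilinearMap.apply ℂ (fun _ : Fin n => E) ℂ
      (fun _ => y)).intervalIntegral_comp_comm ((hcont n).intervalIntegrable
        (μ := MeasureTheory.volume) 0 1)
    simpa using this.symm

/-- `bil · α` as a continuous linear map. -/
noncomputable def bilL {n : ℕ} (α : Fin n → ℂ) : (Fin n → ℂ) →L[ℂ] ℂ :=
  ∑ i, α i • ContinuousLinearMap.proj (R := ℂ) (φ := fun _ : Fin n => ℂ) i

lemma bilL_apply {n : ℕ} (α z : Fin n → ℂ) : bilL α z = bil z α := by
  simp [bilL, bil, mul_comm]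

lemma bil_comm' {n : ℕ} (α z : Fin n → ℂ) : bil α z = bil z α := by
  simp [bil, mul_comm]

lemma division {n : ℕ} (α : Fin n → ℂ) (hα : bil α α ≠ 0)
    (f : (Fin n → ℂ) → ℂ) (hf : ∀ z, AnalyticAt ℂ f z)
    (h0 : ∀ z, bil α z = 0 → f z = 0) :
    ∃ g : (Fin n → ℂ) → ℂ, (∀ z, AnalyticAt ℂ g z) ∧ ∀ z, f z = bil z α * g z := by
  let c := bil α α
  -- the projection to the line spanned by `α`
  let ρ : (Fin n → ℂ) →L[ℂ] (Fin n → ℂ) := (c⁻¹ • bilL α).smulRight α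
  have hρ : ∀ z, ρ z = (c⁻¹ * bil z α) • α := by
    intro z; simp [ρ, bilL_apply]
  let T : ℝ → (Fin n → ℂ) →L[ℂ] (Fin n → ℂ) := fun t =>
    (ContinuousLinearMap.id ℂ _ - ρ) + (t : ℂ) • ρ
  have hT : Continuous T := by fun_prop
  let k : (Fin n → ℂ) → ℂ := fun z => c⁻¹ * fderiv ℂ f z α
  have hk : ∀ z, AnalyticAt ℂ k z := by
    intro z
    have h1 : AnalyticAt ℂ (fun w => fderiv ℂ f w) z := (hf z).fderiv
    have h2 := ((ContinuousLinearMap.apply ℂ ℂ α).analyticAt (fderiv ℂ f z)).comp h1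
    exact analyticAt_const.mul h2
  have hkc : Continuous k := continuous_iff_continuousAt.2 fun z => (hk z).continuousAt
  let g : (Fin n → ℂ) → ℂ := fun z => ∫ t in (0 : ℝ)..1, k (T t z)
  have hTz : ∀ t z, T t z = z - ρ z + (t : ℂ) • ρ z := by intro t z; simp [T]
  have hb0 : ∀ z, bil α (z - ρ z) = 0 := by
    intro z
    rw [bil_comm', ← bilL_apply, map_sub, hρ, map_smul, bilL_apply, bilL_apply]
    change bil z α - (c⁻¹ * bil z α) * c = 0
    have : c ≠ 0 := hα
    field_simp
    simp
  have hfg : ∀ z, f z = bil z α * g z := by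
    intro z
    have hd : ∀ t ∈ Set.uIcc (0 : ℝ) 1,
        HasDerivAt (fun t : ℝ => f (T t z)) (bil z α * k (T t z)) t := by
      intro t _
      have h1 : HasDerivAt (fun t : ℝ => T t z) (ρ z) t := by
        simp only [hTz]
        have := ((Complex.ofRealCLM.hasDerivAt (x := t)).smul_const (ρ z)).const_add (z - ρ z)
        simpa using this
      have h2 := ((hf (T t z)).differentiableAt.hasFDerivAt.restrictScalars ℝ).comp_hasDerivAt t h1
      have e : bil z α * k (T t z) = fderiv ℂ f (T t z) (ρ z) := by
        rw [hρ, map_smul, smul_eq_mul]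
        simp only [k]
        ring
      rw [e]
      exact h2
    have := intervalIntegral.integral_eq_sub_of_hasDerivAt hd (by
      apply Continuous.intervalIntegrable
      exact continuous_const.mul (hkc.comp (by fun_prop)))
    rw [intervalIntegral.integral_const_mul] at this
    change bil z α * g z = _ at this
    have e0 : T 0 z = z - ρ z := by simp [hTz]
    have e1 : T 1 z = z := by simp [hTz]
    rw [e0, e1, h0 _ (hb0 z), sub_zero] at this
    exact this.symm
  refine ⟨g, ?_, hfg⟩
  intro p
  by_cases hp : bil p α = 0
  · have hρp : ρ p = 0 := by simp [hρ, hp]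
    have h1 := analytic_integral_aux k T hT (‖ContinuousLinearMap.id ℂ _ - ρ‖₊ + ‖ρ‖₊ + 1)
      (by positivity) (by
        intro t ht
        rw [Set.uIoc_of_le zero_le_one] at ht
        have h3 : ‖(t : ℂ) • ρ‖ ≤ ‖ρ‖ := by
          rw [norm_smul, Complex.norm_real, Real.norm_eq_abs, abs_of_pos ht.1]
          exact mul_le_of_le_one_left (norm_nonneg _) ht.2
        have := norm_add_le (ContinuousLinearMap.id ℂ _ - ρ) ((t : ℂ) • ρ)
        simp only [T]
        push_cast
        linarith) p (hk p)
    have h2 : AnalyticAt ℂ (fun z => z - p) p := by fun_prop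
    have h3 := AnalyticAt.comp_of_eq h1 h2 (by simp)
    refine h3.congr (Filter.Eventually.of_forall fun z => ?_)
    simp only [Function.comp, g]
    congr 1
    ext t
    have : T t p = p := by simp [hTz, hρp]
    rw [map_sub, this, add_sub_cancel]
  · have hba : AnalyticAt ℂ (fun z => bil z α) p := by
      have := (bilL α).analyticAt p
      refine this.congr (Filter.Eventually.of_forall fun z => bilL_apply α z)
    have h1 := (hf p).div hba hp
    refine h1.congr ?_
    have : ∀ᶠ z in nhds p, bil z α ≠ 0 := hba.continuousAt.eventually_ne hp
    filter_upwards [this] with z hz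
    rw [Pi.div_apply, hfg z]
    field_simp

/-- Step-`d` quotient relation. -/
def QRel {n : ℕ} (α : Fin n → ℂ) (d : ℂ) (f g : (Fin n → ℂ) → ℂ) : Prop :=
  ∀ z, f (z + d • α) - f (z - d • α) = bil z α * g z

/-- Quasi-invariance at `s`. -/
def QInv {n : ℕ} (α : Fin n → ℂ) (f : (Fin n → ℂ) → ℂ) (s : ℂ) : Prop :=
  ∀ z, bil α z = 0 → f (z + s • α) = f (z - s • α)

lemma QInv_zero {n : ℕ} (α : Fin n → ℂ) (f : (Fin n → ℂ) → ℂ) : QInv α f 0 := by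
  intro z _; simp

lemma QRel.inv {n : ℕ} {α : Fin n → ℂ} {d : ℂ} {f g : (Fin n → ℂ) → ℂ}
    (h : QRel α d f g) : QInv α f d := by
  intro z hz
  have := h z
  rw [bil_comm', hz, zero_mul] at this
  exact sub_eq_zero.1 this

lemma exists_QRel {n : ℕ} {α : Fin n → ℂ} (hα : bil α α ≠ 0) {d : ℂ} {f : (Fin n → ℂ) → ℂ}
    (hf : ∀ z, AnalyticAt ℂ f z) (h : QInv α f d) :
    ∃ g : (Fin n → ℂ) → ℂ, (∀ z, AnalyticAt ℂ g z) ∧ QRel α d f g := by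
  refine division α hα (fun z => f (z + d • α) - f (z - d • α)) ?_ ?_
  · intro z
    have h1 : AnalyticAt ℂ (fun z => z + d • α) z := by fun_prop
    have h2 : AnalyticAt ℂ (fun z => z - d • α) z := by fun_prop
    exact ((hf _).comp h1).sub ((hf _).comp h2)
  · intro z hz
    exact sub_eq_zero.2 (h z hz)

lemma QRel.link {n : ℕ} {α : Fin n → ℂ} {d : ℂ} {f g : (Fin n → ℂ) → ℂ}
    (h : QRel α d f g) (s : ℂ) (z : Fin n → ℂ) (hz : bil α z = 0) :
    bil α α * s * (g (z + s • α) - g (z - s • α)) =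
      (f (z + (s + d) • α) - f (z - (s + d) • α)) -
      (f (z + (s - d) • α) - f (z - (s - d) • α)) := by
  have h1 := h (z + s • α)
  have h2 := h (z - s • α)
  rw [bil_comm'] at hz
  have e1 : bil (z + s • α) α = s * bil α α := by
    rw [← bilL_apply, map_add, map_smul, bilL_apply, bilL_apply, hz]; simp
  have e2 : bil (z - s • α) α = - (s * bil α α) := by
    rw [← bilL_apply, map_sub, map_smul, bilL_apply, bilL_apply, hz]; simp
  rw [e1] at h1
  rw [e2] at h2
  have a1 : z + s • α + d • α = z + (s + d) • α := by module
  have a2 : z + s • α - d • α = z + (s - d) • α := by module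
  have a3 : z - s • α + d • α = z - (s - d) • α := by module
  have a4 : z - s • α - d • α = z - (s + d) • α := by module
  rw [a1, a2] at h1
  rw [a3, a4] at h2
  linear_combination -h1 - h2

lemma QRel.down {n : ℕ} {α : Fin n → ℂ} (hα : bil α α ≠ 0) {d : ℂ} {f g : (Fin n → ℂ) → ℂ}
    (h : QRel α d f g) (s a b : ℂ) (hs : s ≠ 0) (ha : a = s + d) (hb : b = s - d)
    (h1 : QInv α f a) (h2 : QInv α f b) : QInv α g s := by
  intro z hz
  have := h.link s z hz
  rw [← ha, ← hb, h1 z hz, h2 z hz, sub_self, sub_self, sub_zero] at this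
  have h3 : bil α α * s ≠ 0 := mul_ne_zero hα hs
  exact sub_eq_zero.1 ((mul_eq_zero.1 this).resolve_left h3)

lemma QRel.up {n : ℕ} {α : Fin n → ℂ} {d : ℂ} {f g : (Fin n → ℂ) → ℂ}
    (h : QRel α d f g) (s a b : ℂ) (ha : a = s + d) (hb : b = s - d)
    (h1 : QInv α g s) (h2 : QInv α f b) : QInv α f a := by
  intro z hz
  have := h.link s z hz
  rw [← ha, ← hb, h1 z hz, h2 z hz, sub_self, sub_self, mul_zero, sub_zero] at this
  exact sub_eq_zero.1 this.symm

/-- First family of conditions. -/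
def ZS {n : ℕ} (α : Fin n → ℂ) (r k : ℕ) (f : (Fin n → ℂ) → ℂ) : Prop :=
  ∀ s : ℕ, ((1 ≤ s ∧ s ≤ k) ∨ (∃ t : ℕ, 1 ≤ t ∧ t ≤ r ∧ s = k + 2 * t)) → QInv α f s

/-- Second family of conditions. -/
def ZE {n : ℕ} (α : Fin n → ℂ) (r : ℕ) (f : (Fin n → ℂ) → ℂ) : Prop :=
  ∀ t : ℕ, 1 ≤ t → t ≤ r → QInv α f ((2 * t : ℕ) : ℂ)

lemma ZS_zero {n : ℕ} (α : Fin n → ℂ) (r : ℕ) (f : (Fin n → ℂ) → ℂ) :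
    ZS α r 0 f ↔ ZE α r f := by
  constructor
  · intro h t h1 h2
    exact h _ (Or.inr ⟨t, h1, h2, by omega⟩)
  · rintro h s (⟨h1, h2⟩ | ⟨t, h1, h2, rfl⟩)
    · omega
    · rw [zero_add]; exact h t h1 h2

lemma ZS_down {n : ℕ} {α : Fin n → ℂ} (hα : bil α α ≠ 0) {r k : ℕ} {f g : (Fin n → ℂ) → ℂ}
    (h : QRel α 1 f g) (hf : ZS α r (k + 1) f) : ZS α r k g := by
  have hf0 : ∀ s : ℕ, s = 0 ∨ ((1 ≤ s ∧ s ≤ k + 1) ∨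
      (∃ t : ℕ, 1 ≤ t ∧ t ≤ r ∧ s = k + 1 + 2 * t)) → QInv α f s := by
    rintro s (rfl | hs)
    · rw [Nat.cast_zero]; exact QInv_zero α f
    · exact hf s hs
  rintro s hs
  have hs1 : 1 ≤ s := by rcases hs with h | ⟨t, h⟩ <;> omega
  refine h.down hα s ((s + 1 : ℕ) : ℂ) ((s - 1 : ℕ) : ℂ) (by norm_cast; omega) (by push_cast; ring)
    (by rw [Nat.cast_sub hs1]; simp) (hf _ ?_) (hf0 _ ?_)
  · rcases hs with h | ⟨t, h1, h2, h3⟩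
    · left; omega
    · right; exact ⟨t, h1, h2, by omega⟩
  · rcases hs with h | ⟨t, h1, h2, h3⟩
    · omega
    · by_cases ht : t = 1
      · omega
      · right; right; exact ⟨t - 1, by omega, by omega, by omega⟩

lemma ZS_up {n : ℕ} {α : Fin n → ℂ} {r k : ℕ} {f g : (Fin n → ℂ) → ℂ}
    (h : QRel α 1 f g) (hg : ZS α r k g) : ZS α r (k + 1) f := by
  intro s
  induction s using Nat.strong_induction_on with
  | _ s ih =>
  intro hs
  have hs1 : 1 ≤ s := by rcases hs with h | ⟨t, h⟩ <;> omega
  by_cases h1 : s = 1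
  · subst h1; rw [Nat.cast_one]; exact h.inv
  refine h.up ((s - 1 : ℕ) : ℂ) s ((s - 2 : ℕ) : ℂ) (by rw [Nat.cast_sub hs1]; simp)
    (by rw [Nat.cast_sub hs1, Nat.cast_sub (by omega)]; push_cast; ring) (hg _ ?_) ?_
  · rcases hs with h | ⟨t, h1, h2, h3⟩
    · left; omega
    · right; exact ⟨t, h1, h2, by omega⟩
  · by_cases h2 : s = 2
    · subst h2; simpa using QInv_zero α f
    apply ih _ (by omega)
    rcases hs with h | ⟨t, h1, h2, h3⟩
    · left; omega
    · by_cases ht : t = 1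
      · left; omega
      · right; exact ⟨t - 1, by omega, by omega, by omega⟩

lemma ZE_down {n : ℕ} {α : Fin n → ℂ} (hα : bil α α ≠ 0) {r : ℕ} {f g : (Fin n → ℂ) → ℂ}
    (h : QRel α 2 f g) (hf : ZE α (r + 1) f) : ZE α r g := by
  intro t ht1 ht2
  refine h.down hα _ ((2 * (t + 1) : ℕ) : ℂ) ((2 * (t - 1) : ℕ) : ℂ) (by norm_cast; omega)
    (by push_cast; ring) (by push_cast [Nat.cast_sub ht1]; ring)
    (hf _ (by omega) (by omega)) ?_
  by_cases h1 : t = 1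
  · subst h1; simpa using QInv_zero α f
  · exact hf _ (by omega) (by omega)

lemma ZE_up {n : ℕ} {α : Fin n → ℂ} {r : ℕ} {f g : (Fin n → ℂ) → ℂ}
    (h : QRel α 2 f g) (hg : ZE α r g) : ZE α (r + 1) f := by
  intro s
  induction s using Nat.strong_induction_on with
  | _ s ih =>
  intro hs1 hs2
  by_cases h1 : s = 1
  · subst h1; simpa using h.inv
  refine h.up ((2 * (s - 1) : ℕ) : ℂ) _ ((2 * (s - 2) : ℕ) : ℂ)
    (by push_cast [Nat.cast_sub hs1]; ring)
    (by push_cast [Nat.cast_sub hs1, Nat.cast_sub (show 2 ≤ s by omega)]; ring)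
    (hg _ (by omega) (by omega)) ?_
  by_cases h2 : s = 2
  · subst h2; simpa using QInv_zero α f
  · exact ih _ (by omega) (by omega) (by omega)

lemma chain_exists {X : Type*} (R : X → X → Prop) (P : ℕ → X → Prop)
    (step : ∀ k f, P (k + 1) f → ∃ g, R f g ∧ P k g) :
    ∀ k f, P k f → ∃ G : ℕ → X, G 0 = f ∧ (∀ q ≤ k, P (k - q) (G q)) ∧
      ∀ q < k, R (G q) (G (q + 1)) := by
  intro k
  induction k with
  | zero =>
    intro f hf
    refine ⟨fun _ => f, rfl, ?_, ?_⟩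
    · intro q hq
      simpa using hf
    · intro q hq; omega
  | succ k ih =>
    intro f hf
    obtain ⟨g, hg, hPg⟩ := step k f hf
    obtain ⟨G, hG0, hG1, hG2⟩ := ih g hPg
    refine ⟨fun q => Nat.casesOn q f G, rfl, ?_, ?_⟩
    · intro q hq
      cases q with
      | zero => exact hf
      | succ q =>
        have := hG1 q (by omega)
        rw [show k + 1 - (q + 1) = k - q by omega]
        exact this
    · intro q hq
      cases q with
      | zero => simpa [hG0] using hg
      | succ q => exact hG2 q (by omega)

lemma chain_back {X : Type*} (R : X → X → Prop) (P : ℕ → X → Prop)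
    (step : ∀ k f g, R f g → P k g → P (k + 1) f) :
    ∀ k (G : ℕ → X), (∀ q < k, R (G q) (G (q + 1))) → P 0 (G k) → P k (G 0) := by
  intro k
  induction k with
  | zero => intro G _ h; exact h
  | succ k ih =>
    intro G hG h
    exact step k _ _ (hG 0 (by omega)) (ih (fun q => G (q + 1)) (fun q hq => hG _ (by omega)) h)

/-- Multi-dimensional characterisation of the quasi-invariance
conditions of a Baker–Akhiezer function on the hyperplane `⟨α,z⟩ = 0`. -/
theorem stmt_1 (n : ℕ) (hn : 1 ≤ n) (α : Fin n → ℂ) (hα : bil α α ≠ 0)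
    (mα m2α : ℕ) (hmα : 1 ≤ mα)
    (ψ : (Fin n → ℂ) → ℂ) (hψ : ∀ z, AnalyticAt ℂ ψ z) :
    (∀ s : ℕ, ((1 ≤ s ∧ s ≤ mα) ∨ (∃ t : ℕ, 1 ≤ t ∧ t ≤ m2α ∧ s = mα + 2 * t)) →
      ∀ z : Fin n → ℂ, bil α z = 0 →
        ψ (z + (s : ℂ) • α) = ψ (z - (s : ℂ) • α))
    ↔
    (∃ G : ℕ → (Fin n → ℂ) → ℂ,
      (∀ q : ℕ, 1 ≤ q → q ≤ mα → ∀ z, AnalyticAt ℂ (G q) z) ∧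
      (∀ z : Fin n → ℂ, ψ (z + α) - ψ (z - α) = bil z α * G 1 z) ∧
      (∀ q : ℕ, 1 ≤ q → q ≤ mα - 1 →
        ∀ z : Fin n → ℂ, G q (z + α) - G q (z - α) = bil z α * G (q + 1) z) ∧
      (1 ≤ m2α →
        ∃ H : ℕ → (Fin n → ℂ) → ℂ,
          (∀ t : ℕ, 1 ≤ t → t ≤ m2α → ∀ z, AnalyticAt ℂ (H t) z) ∧
          (∀ z : Fin n → ℂ,
            G mα (z + (2 : ℂ) • α) - G mα (z - (2 : ℂ) • α) = bil z α * H 1 z) ∧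
          (∀ t : ℕ, 1 ≤ t → t ≤ m2α - 1 →
            ∀ z : Fin n → ℂ,
              H t (z + (2 : ℂ) • α) - H t (z - (2 : ℂ) • α) = bil z α * H (t + 1) z))) := by
  constructor
  · intro h
    have h' : ZS α m2α mα ψ := h
    obtain ⟨G, hG0, hG1, hG2⟩ := chain_exists (QRel α 1)
      (fun k f => (∀ z, AnalyticAt ℂ f z) ∧ ZS α m2α k f) (by
        rintro k f ⟨hf, hz⟩
        obtain ⟨g, hg, hfg⟩ := exists_QRel hα hf (d := 1) (by
          simpa using hz 1 (Or.inl ⟨le_rfl, by omega⟩))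
        exact ⟨g, hfg, hg, ZS_down hα hfg hz⟩) mα ψ ⟨hψ, h'⟩
    refine ⟨G, fun q _ hq => (hG1 q hq).1, ?_, ?_, ?_⟩
    · intro z
      have := hG2 0 (by omega) z
      rw [hG0] at this
      simpa using this
    · intro q _ hq z
      simpa using hG2 q (by omega) z
    · intro _
      have hm := hG1 mα le_rfl
      rw [Nat.sub_self, ZS_zero] at hm
      obtain ⟨H, hH0, hH1, hH2⟩ := chain_exists (QRel α 2)
        (fun k f => (∀ z, AnalyticAt ℂ f z) ∧ ZE α k f) (by
          rintro k f ⟨hf, hz⟩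
          obtain ⟨g, hg, hfg⟩ := exists_QRel hα hf (d := 2) (by
            simpa using hz 1 le_rfl (by omega))
          exact ⟨g, hfg, hg, ZE_down hα hfg hz⟩) m2α (G mα) hm
      refine ⟨H, fun q _ hq => (hH1 q hq).1, ?_, ?_⟩
      · intro z
        have := hH2 0 (by omega) z
        rwa [hH0] at this
      · intro q _ hq z
        exact hH2 q (by omega) z
  · rintro ⟨G, -, hG1, hG2, hH⟩
    have hE : ZE α m2α (G mα) := by
      by_cases hm : 1 ≤ m2α
      · obtain ⟨H, -, hH1, hH2⟩ := hH hm
        have := chain_back (QRel α 2) (ZE α) (fun k f g => ZE_up) m2α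
          (fun t => if t = 0 then G mα else H t) (by
            intro t ht
            by_cases h0 : t = 0
            · subst h0; intro z; simpa using hH1 z
            · intro z; simpa [h0] using hH2 t (by omega) (by omega) z) (by intro t h1 h2; omega)
        simpa using this
      · intro t h1 h2; omega
    have := chain_back (QRel α 1) (ZS α m2α) (fun k f g => ZS_up) mα
      (fun q => if q = 0 then ψ else G q) (by
        intro q hq
        by_cases h0 : q = 0
        · subst h0; intro z; simpa using hG1 z
        · intro z; simpa [h0] using hG2 q (by omega) (by omega) z) (by
        rw [ZS_zero]
        simpa [show mα ≠ 0 by omega] using hE)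
    exact this
end

section
/- Let n ≥ 1, let α ∈ ℂⁿ with α² = ⟨α,α⟩ ≠ 0, let m_α ≥ 1 and m_{2α} ≥ 0 be integers, and let x ∈ ℂⁿ satisfy sinh⟨α,x⟩ ≠ 0 and sinh⟨2α,x⟩ ≠ 0. Let P ∈ ℂ[z₁,…,zₙ] be a nonzero polynomial of total degree N, and let P₀ be its homogeneous component of degree N. Suppose the function ψ(z) = P(z)·exp⟨z,x⟩ satisfies: for every s ∈ {1, …, m_α} ∪ {m_α+2, m_α+4, …, m_α+2m_{2α}}, ψ(z+sα) = ψ(z−sα) for every z with ⟨α,z⟩ = 0. Then ⟨α,z⟩^{m_α+m_{2α}} divides P₀ in ℂ[z₁,…,zₙ]. -/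
/-- The linear form `z ↦ ⟨α, z⟩` as a polynomial in `z₁, …, zₙ`. -/
noncomputable def linForm {n : ℕ} (α : Fin n → ℂ) : MvPolynomial (Fin n) ℂ :=
  ∑ i, MvPolynomial.C (α i) * MvPolynomial.X i

/-- The exponents minus one. -/
def expo (m i : ℕ) : ℕ := if i < m then i else m + 2 * (i - m) + 1

lemma expo_inj (m : ℕ) : Function.Injective (expo m) := by
  intro i j h
  unfold expo at h
  split_ifs at h <;> omega

open Polynomial in
lemma even_poly_zero (G : ℂ[X]) (l : ℕ) (w : ℂ) (hw : w ≠ 0) (hG : G.comp (-X) = G)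
    (hd : G.natDegree ≤ 2 * l) (hdvd : (X - C w) ^ (l + 1) ∣ G) : G = 0 := by
  have h2 : (X - C (-w)) ^ (l + 1) ∣ G := by
    have := hdvd
    rw [← hG, dvd_comp_neg_X_iff] at this
    simp only [pow_comp, sub_comp, X_comp, C_comp] at this
    have e : (-X - C w) ^ (l+1) = (-1) ^ (l+1) * (X - C (-w)) ^ (l+1) := by
      rw [← mul_pow]; congr 1; simp; ring
    rw [e] at this
    exact dvd_of_mul_left_dvd this
  have hc : IsCoprime ((X - C w) ^ (l + 1)) ((X - C (-w)) ^ (l + 1)) := by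
    apply IsCoprime.pow
    apply isCoprime_X_sub_C_of_isUnit_sub
    rw [isUnit_iff_ne_zero]
    intro h
    apply hw
    linear_combination h / 2
  have h3 := hc.mul_dvd hdvd h2
  by_contra h0
  have := natDegree_le_of_dvd h3 h0
  rw [natDegree_mul (pow_ne_zero _ (X_sub_C_ne_zero _)) (pow_ne_zero _ (X_sub_C_ne_zero _))] at this
  simp only [natDegree_pow, natDegree_X_sub_C] at this
  omega

open Polynomial in
lemma iter_der_comp_neg (p : ℂ[X]) (k : ℕ) :
    (derivative^[k] p).comp (-X) = (-1) ^ k * derivative^[k] (p.comp (-X)) := by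
  induction k generalizing p with
  | zero => simp
  | succ k ih =>
    simp only [Function.iterate_succ, Function.comp]
    rw [ih, derivative_comp, derivative_neg, derivative_X, neg_one_mul, iterate_derivative_neg]
    ring

open Polynomial in
lemma U_comp_neg (n : ℕ) : (Chebyshev.U ℂ n).comp (-X) = (-1) ^ n * Chebyshev.U ℂ n := by
  apply Polynomial.funext
  intro r
  rw [eval_comp]
  simp [Chebyshev.U_eval_neg]

open Polynomial in
lemma poly_key (m l : ℕ) (hm : 1 ≤ m) (c : Fin (m + l) → ℂ) (w : ℂ) (hw : w ≠ 0)
    (hdvd : (X - C w) ^ (m + l) ∣ ∑ i, c i • Chebyshev.U ℂ (expo m i : ℕ)) : c = 0 := by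
  set F := ∑ i, c i • Chebyshev.U ℂ (expo m i : ℕ) with hF
  have hlin : LinearIndependent ℂ (fun i : Fin (m + l) => Chebyshev.U ℂ (expo m i : ℕ)) := by
    let S : Polynomial.Sequence ℂ := ⟨fun n => Chebyshev.U ℂ n, fun n => Chebyshev.degree_U_natCast ℂ n⟩
    exact S.linearIndependent.comp (fun i : Fin (m+l) => expo m i)
      ((expo_inj m).comp Fin.val_injective)
  have hFd : F.natDegree ≤ m - 1 + 2 * l := by
    apply natDegree_sum_le_of_forall_le
    intro i _
    refine (natDegree_smul_le _ _).trans ?_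
    rw [Chebyshev.natDegree_U_natCast]
    have := i.2
    unfold expo
    split_ifs <;> omega
  have hG : derivative^[m-1] F = 0 := by
    apply even_poly_zero _ l w hw
    · rw [hF, iterate_derivative_sum, sum_comp]
      refine Finset.sum_congr rfl fun i _ => ?_
      rw [iterate_derivative_smul, smul_comp]
      congr 1
      by_cases hi : (i : ℕ) < m
      · have : (derivative^[m-1] (Chebyshev.U ℂ (expo m i : ℕ))).natDegree = 0 := by
          have := natDegree_iterate_derivative (Chebyshev.U ℂ (expo m i : ℕ)) (m-1)
          rw [Chebyshev.natDegree_U_natCast] at this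
          simp only [expo, hi, if_true] at this ⊢
          omega
        rw [eq_C_of_natDegree_eq_zero this, C_comp]
      · rw [iter_der_comp_neg, U_comp_neg]
        have : (-1 : ℂ[X]) ^ (expo m i) = (-1) ^ (m-1) := by
          have : expo m i = (m - 1) + 2 * (i - m + 1) := by simp only [expo, hi, if_false]; omega
          rw [this, pow_add, pow_mul]; simp
        rw [this]
        have h2 : ((-1 : ℂ[X]) ^ (m-1)) = C ((-1) ^ (m-1)) := by simp
        rw [h2, iterate_derivative_C_mul, ← mul_assoc, ← C_mul, ← mul_pow]
        simp
    · have := natDegree_iterate_derivative F (m-1)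
      omega
    · have := pow_sub_dvd_iterate_derivative_of_pow_dvd (m-1) hdvd
      rwa [show m + l - (m-1) = l + 1 by omega] at this
  have hF0 : F = 0 := by
    by_contra h0
    have h1 := natDegree_le_of_dvd hdvd h0
    simp only [natDegree_pow, natDegree_X_sub_C, mul_one] at h1
    have h2 : (derivative^[m-1] F).coeff (F.natDegree - (m-1)) ≠ 0 := by
      rw [coeff_iterate_derivative, show F.natDegree - (m-1) + (m-1) = F.natDegree by omega]
      simp [Nat.descFactorial_eq_zero_iff_lt, h0]
      omega
    rw [hG] at h2
    simp at h2
  funext i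
  exact (Fintype.linearIndependent_iff.1 hlin) c hF0 i

open Polynomial in
lemma dvd_of_order (F : ℂ[X]) (w : ℂ) (M : ℕ)
    (h : (M : ℕ∞) ≤ analyticOrderAt (fun z => F.eval z) w) : (X - C w) ^ M ∣ F := by
  by_cases h0 : F = 0
  · simp [h0]
  rw [← le_rootMultiplicity_iff h0]
  obtain ⟨G, hG, hnd⟩ := exists_eq_pow_rootMultiplicity_mul_and_not_dvd F h0 w
  have : analyticOrderAt (fun z => F.eval z) w = rootMultiplicity w F := by
    rw [AnalyticAt.analyticOrderAt_eq_natCast]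
    · refine ⟨fun z => G.eval z, ?_, ?_, ?_⟩
      · exact AnalyticOnNhd.eval_polynomial G w (Set.mem_univ _)
      · rwa [dvd_iff_isRoot] at hnd
      · refine Filter.Eventually.of_forall fun z => ?_
        conv_lhs => rw [hG]
        simp
    · exact AnalyticOnNhd.eval_polynomial F w (Set.mem_univ _)
  rw [this] at h
  exact_mod_cast h

lemma iter_der (k : ℕ) {ι : Type*} [Fintype ι] (c : ι → ℂ) (s : ι → ℂ) :
    iteratedDeriv k (fun z => ∑ i, c i * Complex.sinh (s i * z)) =
      fun z => ∑ i, c i * (s i ^ k * (Complex.exp (s i * z) - (-1) ^ k * Complex.exp (- (s i * z)))) / 2 := by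
  induction k with
  | zero => 
    funext z
    simp [Complex.sinh, mul_div_assoc]
  | succ k ih =>
    rw [iteratedDeriv_succ, ih]
    funext z
    apply HasDerivAt.deriv
    apply HasDerivAt.fun_sum
    intro i _
    have h1 : HasDerivAt (fun z => s i * z) (s i) z := by simpa using (hasDerivAt_id z).const_mul (s i)
    have := (((h1.cexp.sub (h1.neg.cexp.const_mul ((-1) ^ k))).const_mul (s i ^ k)).const_mul (c i)).div_const 2
    refine HasDerivAt.congr_deriv (this : HasDerivAt (fun x => c i * (s i ^ k *
      (Complex.exp (s i * x) - (-1) ^ k * Complex.exp (-(s i * x)))) / 2) _ z) ?_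
    change c i * (s i ^ k * (Complex.exp (s i * z) * s i -
      (-1) ^ k * (Complex.exp (-(s i * z)) * -s i))) / 2 = _
    ring

lemma mat_key (m l : ℕ) (hm : 1 ≤ m) (θ : ℂ) (h1 : Complex.sinh θ ≠ 0)
    (h2 : Complex.cosh θ ≠ 0) (c : Fin (m + l) → ℂ)
    (hc : ∀ k < m + l, ∑ i : Fin (m + l), c i * (((expo m i : ℂ) + 1) ^ k *
      (Complex.exp (((expo m i : ℂ) + 1) * θ) - (-1) ^ k * Complex.exp (- (((expo m i : ℂ) + 1) * θ)))) = 0) :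
    c = 0 := by
  apply poly_key m l hm c (Complex.cosh θ) h2
  apply dvd_of_order
  set F := ∑ i, c i • Polynomial.Chebyshev.U ℂ (expo m i : ℕ) with hF
  have han : AnalyticAt ℂ Complex.cosh θ := Complex.differentiable_cosh.analyticAt θ
  have hans : AnalyticAt ℂ Complex.sinh θ := Complex.differentiable_sinh.analyticAt θ
  have hanF : AnalyticAt ℂ (fun z => F.eval z) (Complex.cosh θ) :=
    AnalyticOnNhd.eval_polynomial F _ (Set.mem_univ _)
  rw [← analyticOrderAt_comp_of_deriv_ne_zero han (by simpa using h1)]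
  have e : ((fun z => F.eval z) ∘ Complex.cosh) * Complex.sinh =
      fun z => ∑ i, c i * Complex.sinh (((expo m i : ℂ) + 1) * z) := by
    funext z
    simp only [Pi.mul_apply, Function.comp, hF, Polynomial.eval_finsetSum, Finset.sum_mul,
      Polynomial.eval_smul, smul_eq_mul, mul_assoc]
    refine Finset.sum_congr rfl fun i _ => ?_
    rw [Polynomial.Chebyshev.U_complex_cosh]
    simp
  have h0 : analyticOrderAt Complex.sinh θ = 0 := by
    rw [analyticOrderAt_eq_zero]; right; exact h1
  have e2 := analyticOrderAt_mul (hanF.comp han) hans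
  rw [h0, add_zero] at e2
  rw [← e2, e, natCast_le_analyticOrderAt_iff_iteratedDeriv_eq_zero]
  · intro k hk
    rw [iter_der]
    beta_reduce
    rw [← Finset.sum_div, hc k hk, zero_div]
  · rw [← e]; exact (hanF.comp han).mul hans

lemma mat_key2 (m l : ℕ) (hm : 1 ≤ m) (θ : ℂ) (h1 : Complex.sinh θ ≠ 0)
    (h2 : Complex.cosh θ ≠ 0) (v : ℕ → ℂ)
    (hv : ∀ i < m + l, ∑ k ∈ Finset.range (m + l), (((expo m i : ℂ) + 1) ^ k *
      (Complex.exp (((expo m i : ℂ) + 1) * θ) - (-1) ^ k * Complex.exp (- (((expo m i : ℂ) + 1) * θ)))) * v k = 0) :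
    ∀ k < m + l, v k = 0 := by
  let A : Matrix (Fin (m+l)) (Fin (m+l)) ℂ := fun i k => (((expo m i : ℂ) + 1) ^ (k : ℕ) *
      (Complex.exp (((expo m i : ℂ) + 1) * θ) - (-1) ^ (k : ℕ) * Complex.exp (- (((expo m i : ℂ) + 1) * θ))))
  have hA : A.det ≠ 0 := by
    intro h
    obtain ⟨c, hc0, hc⟩ := Matrix.exists_vecMul_eq_zero_iff.2 h
    apply hc0
    apply mat_key m l hm θ h1 h2
    intro k hk
    exact congrFun hc ⟨k, hk⟩
  by_contra hcon
  push Not at hcon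
  obtain ⟨k, hk, hvk⟩ := hcon
  apply hA
  rw [← Matrix.exists_mulVec_eq_zero_iff]
  refine ⟨fun k => v k, fun h => hvk (congrFun h ⟨k, hk⟩), ?_⟩
  funext i
  have := hv i i.2
  rw [Finset.sum_range] at this
  exact this

/-- Restriction of a polynomial to an affine line. -/
noncomputable def lineP {n : ℕ} (y α : Fin n → ℂ) (Q : MvPolynomial (Fin n) ℂ) : Polynomial ℂ :=
  MvPolynomial.aeval (fun i => Polynomial.C (y i) + Polynomial.C (α i) * Polynomial.X) Q

lemma eval_lineP {n : ℕ} (y α : Fin n → ℂ) (Q : MvPolynomial (Fin n) ℂ) (t : ℂ) :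
    (lineP y α Q).eval t = MvPolynomial.eval (y + t • α) Q := by
  unfold lineP
  rw [← Polynomial.coe_evalRingHom, ← MvPolynomial.eval₂_id, MvPolynomial.aeval_def,
    MvPolynomial.hom_eval₂]
  congr 1
  · ext; simp
  · funext i; simp; ring

lemma natDegree_lineP {n : ℕ} (y α : Fin n → ℂ) (Q : MvPolynomial (Fin n) ℂ) (d : ℕ)
    (hQ : Q.IsHomogeneous d) : (lineP y α Q).natDegree ≤ d := by
  unfold lineP
  refine (MvPolynomial.aeval_natDegree_le (n := 1) Q (hQ.totalDegree_le) _ ?_).trans (by simp)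
  intro i
  compute_degree

lemma eval_smul_hom {n : ℕ} (z : Fin n → ℂ) (Q : MvPolynomial (Fin n) ℂ) (d : ℕ)
    (hQ : Q.IsHomogeneous d) (u : ℂ) :
    MvPolynomial.eval (u • z) Q = u ^ d * MvPolynomial.eval z Q := by
  rw [MvPolynomial.eval_eq', MvPolynomial.eval_eq', Finset.mul_sum]
  refine Finset.sum_congr rfl fun e he => ?_
  have hd : ∑ i, e i = d := by
    have := hQ (MvPolynomial.mem_support_iff.1 he)
    rw [← this, Finsupp.weight_apply, Finsupp.sum_fintype] <;> simp
  simp only [Pi.smul_apply, smul_eq_mul, mul_pow, Finset.prod_mul_distrib, Finset.prod_pow_eq_pow_sum, hd]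
  ring

/-- coefficients -/
noncomputable def cf {n : ℕ} (y α : Fin n → ℂ) (P : MvPolynomial (Fin n) ℂ) (d k : ℕ) : ℂ :=
  (lineP y α (MvPolynomial.homogeneousComponent d P)).coeff k

lemma eval_expand {n : ℕ} (y α : Fin n → ℂ) (P : MvPolynomial (Fin n) ℂ) (u t : ℂ) (hu : u ≠ 0) :
    MvPolynomial.eval (u • y + t • α) P =
      ∑ d ∈ Finset.range (P.totalDegree + 1), ∑ k ∈ Finset.range (d + 1),
        u ^ (d - k) * t ^ k * cf y α P d k := by
  conv_lhs => rw [← MvPolynomial.sum_homogeneousComponent P, map_sum]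
  refine Finset.sum_congr rfl fun d _ => ?_
  have e : u • y + t • α = u • (y + (t / u) • α) := by
    rw [smul_add, smul_smul, mul_div_cancel₀ _ hu]
  have hh := MvPolynomial.homogeneousComponent_isHomogeneous d P
  rw [e, eval_smul_hom _ _ d hh, ← eval_lineP,
    Polynomial.eval_eq_sum_range' (Nat.lt_succ_of_le (natDegree_lineP y α _ d hh)), Finset.mul_sum]
  refine Finset.sum_congr rfl fun k hk => ?_
  have hk' : k ≤ d := by simpa [Nat.lt_succ_iff] using hk
  unfold cf
  obtain ⟨j, rfl⟩ := Nat.exists_eq_add_of_le hk'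
  rw [Nat.add_sub_cancel_left, div_pow, pow_add]
  field_simp

lemma coeff_rel {n : ℕ} (y α x : Fin n → ℂ) (P : MvPolynomial (Fin n) ℂ) (s : ℂ)
    (hy : bil α y = 0)
    (hq : ∀ z : Fin n → ℂ, bil α z = 0 →
        MvPolynomial.eval (z + s • α) P * Complex.exp (bil (z + s • α) x)
          = MvPolynomial.eval (z - s • α) P * Complex.exp (bil (z - s • α) x)) (e : ℕ) :
    ∑ d ∈ Finset.range (P.totalDegree + 1), ∑ k ∈ Finset.range (d + 1),
      (if e = d - k then (s ^ k * (Complex.exp (s * bil α x) - (-1) ^ k *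
        Complex.exp (-(s * bil α x)))) * cf y α P d k else 0) = 0 := by
  let W : Polynomial ℂ := ∑ d ∈ Finset.range (P.totalDegree + 1), ∑ k ∈ Finset.range (d + 1),
      Polynomial.C ((s ^ k * (Complex.exp (s * bil α x) - (-1) ^ k *
        Complex.exp (-(s * bil α x)))) * cf y α P d k) * Polynomial.X ^ (d - k)
  have hW : W = 0 := by
    apply Polynomial.eq_zero_of_infinite_isRoot
    refine Set.Infinite.mono ?_ (Set.Finite.infinite_compl (Set.finite_singleton (0 : ℂ)))
    intro u hu
    have hu : u ≠ 0 := hu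
    have h1 := hq (u • y) (by
      have : bil α (u • y) = u * bil α y := by
        simp only [bil, Finset.mul_sum, Pi.smul_apply, smul_eq_mul]
        exact Finset.sum_congr rfl fun i _ => by ring
      rw [this, hy, mul_zero])
    have b : ∀ t : ℂ, bil (u • y + t • α) x = bil (u • y) x + t * bil α x := by
      intro t
      simp only [bil, Finset.mul_sum, ← Finset.sum_add_distrib, Pi.add_apply, Pi.smul_apply, smul_eq_mul]
      exact Finset.sum_congr rfl fun i _ => by ring
    rw [sub_eq_add_neg, ← neg_smul, b, b, Complex.exp_add, Complex.exp_add,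
      eval_expand _ _ _ _ _ hu, eval_expand _ _ _ _ _ hu] at h1
    have h2 := Complex.exp_ne_zero (bil (u • y) x)
    have h3 : (∑ d ∈ Finset.range (P.totalDegree + 1), ∑ k ∈ Finset.range (d + 1),
        u ^ (d - k) * s ^ k * cf y α P d k) * Complex.exp (s * bil α x) =
        (∑ d ∈ Finset.range (P.totalDegree + 1), ∑ k ∈ Finset.range (d + 1),
        u ^ (d - k) * (-s) ^ k * cf y α P d k) * Complex.exp (-s * bil α x) := by
      apply mul_left_cancel₀ h2
      linear_combination h1
    rw [← sub_eq_zero] at h3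
    simp only [Set.mem_ofPred_eq, Polynomial.IsRoot, W, Polynomial.eval_finsetSum]
    rw [← h3]
    simp only [Finset.sum_mul, ← Finset.sum_sub_distrib]
    refine Finset.sum_congr rfl fun d _ => Finset.sum_congr rfl fun k _ => ?_
    simp only [Polynomial.eval_mul, Polynomial.eval_C, Polynomial.eval_pow, Polynomial.eval_X]
    rw [neg_pow s, neg_mul]
    ring
  have := congrArg (fun p => Polynomial.coeff p e) hW
  simp only [W, Polynomial.finsetSum_coeff, Polynomial.coeff_C_mul_X_pow, Polynomial.coeff_zero] at this
  exact this

lemma coeff_rel' {n : ℕ} (y α x : Fin n → ℂ) (P : MvPolynomial (Fin n) ℂ) (s : ℂ)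
    (hy : bil α y = 0)
    (hq : ∀ z : Fin n → ℂ, bil α z = 0 →
        MvPolynomial.eval (z + s • α) P * Complex.exp (bil (z + s • α) x)
          = MvPolynomial.eval (z - s • α) P * Complex.exp (bil (z - s • α) x)) (j M : ℕ)
    (hj : j ≤ P.totalDegree) (hM : j < M) :
    ∑ k ∈ Finset.range M, (s ^ k * (Complex.exp (s * bil α x) - (-1) ^ k *
        Complex.exp (-(s * bil α x)))) *
        (if k ≤ j then cf y α P (P.totalDegree - j + k) k else 0) = 0 := by
  refine Eq.trans ?_ (coeff_rel y α x P s hy hq (P.totalDegree - j))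
  set f : ℕ → ℂ := fun k => (s ^ k * (Complex.exp (s * bil α x) - (-1) ^ k *
        Complex.exp (-(s * bil α x)))) with hf
  set N := P.totalDegree with hN
  have e1 : ∑ k ∈ Finset.range M, f k * (if k ≤ j then cf y α P (N - j + k) k else 0) =
      ∑ k ∈ Finset.range (j + 1), f k * cf y α P (N - j + k) k := by
    symm
    apply Finset.sum_subset_zero_on_sdiff
    · intro k hk; simp at hk ⊢; omega
    · intro k hk; simp at hk; simp [show ¬ k ≤ j by omega]
    · intro k hk; simp only [Finset.mem_range] at hk; rw [if_pos (by omega)]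
  have e2 : ∀ d ∈ Finset.range (N + 1), ∑ k ∈ Finset.range (d + 1),
      (if N - j = d - k then f k * cf y α P d k else 0) =
      if N - j ≤ d then f (d - (N - j)) * cf y α P d (d - (N - j)) else 0 := by
    intro d hd
    split_ifs with h
    · rw [Finset.sum_eq_single (d - (N - j))]
      · rw [if_pos (by omega)]
      · intro b hb hb2
        simp at hb
        rw [if_neg (by omega)]
      · intro hb; simp only [Finset.mem_range] at hb; omega
    · apply Finset.sum_eq_zero
      intro k hk
      rw [if_neg (by omega)]
  rw [e1, Finset.sum_congr rfl e2, ← Finset.sum_filter]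
  apply Finset.sum_bij (fun k _ => N - j + k)
  · intro k hk; simp at hk ⊢; omega
  · intro a _ b _ h; omega
  · intro d hd
    simp at hd
    exact ⟨d - (N - j), by simp; try omega, by omega⟩
  · intro k hk
    simp

theorem stmt_2 (n : ℕ) (hn : 1 ≤ n) (α : Fin n → ℂ) (hα : bil α α ≠ 0)
    (mα m2α : ℕ) (hmα : 1 ≤ mα)
    (x : Fin n → ℂ) (hx1 : Complex.sinh (bil α x) ≠ 0)
    (hx2 : Complex.sinh (bil ((2 : ℂ) • α) x) ≠ 0)
    (P : MvPolynomial (Fin n) ℂ) (hP : P ≠ 0)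
    (hquasi : ∀ s : ℕ,
      ((1 ≤ s ∧ s ≤ mα) ∨ (∃ t : ℕ, 1 ≤ t ∧ t ≤ m2α ∧ s = mα + 2 * t)) →
      ∀ z : Fin n → ℂ, bil α z = 0 →
        MvPolynomial.eval (z + (s : ℂ) • α) P * Complex.exp (bil (z + (s : ℂ) • α) x)
          = MvPolynomial.eval (z - (s : ℂ) • α) P * Complex.exp (bil (z - (s : ℂ) • α) x)) :
    (linForm α) ^ (mα + m2α) ∣ MvPolynomial.homogeneousComponent P.totalDegree P := by
  have hcosh : Complex.cosh (bil α x) ≠ 0 := by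
    have : bil ((2 : ℂ) • α) x = 2 * bil α x := by
      simp only [bil, Finset.mul_sum, Pi.smul_apply, smul_eq_mul]
      exact Finset.sum_congr rfl fun i _ => by ring
    rw [this, Complex.sinh_two_mul] at hx2
    exact right_ne_zero_of_mul hx2
  -- pointwise vanishing of the low coefficients
  have key : ∀ y, bil α y = 0 → ∀ j < mα + m2α, cf y α P P.totalDegree j = 0 := by
    intro y hy j hj
    by_cases hjN : j ≤ P.totalDegree
    · have := mat_key2 mα m2α hmα (bil α x) hx1 hcosh
        (fun k => if k ≤ j then cf y α P (P.totalDegree - j + k) k else 0) (by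
          intro i hi
          have h := coeff_rel' y α x P (((expo mα i + 1 : ℕ) : ℂ)) hy (hquasi (expo mα i + 1) (by
            unfold expo
            split_ifs with h
            · left; omega
            · right; exact ⟨i - mα + 1, by omega, by omega, by omega⟩)) j (mα + m2α) hjN hj
          push_cast at h
          exact h) j hj
      simpa [Nat.sub_add_cancel hjN] using this
    · apply Polynomial.coeff_eq_zero_of_natDegree_lt
      exact lt_of_le_of_lt (natDegree_lineP y α _ _
        (MvPolynomial.homogeneousComponent_isHomogeneous _ P)) (by omega)
  set P0 := MvPolynomial.homogeneousComponent P.totalDegree P with hP0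
  set a := bil α α with ha
  let Y : Fin n → MvPolynomial (Fin n) ℂ :=
    fun i => MvPolynomial.X i - MvPolynomial.C (α i / a) * linForm α
  let Q : Polynomial (MvPolynomial (Fin n) ℂ) :=
    MvPolynomial.aeval (fun i => Polynomial.C (Y i) +
      Polynomial.C (MvPolynomial.C (α i)) * Polynomial.X) P0
  have hQ1 : Q.eval (MvPolynomial.C (1 / a) * linForm α) = P0 := by
    have : (Polynomial.evalRingHom (MvPolynomial.C (1 / a) * linForm α)) Q = P0 := by
      simp only [Q]
      rw [MvPolynomial.aeval_def, MvPolynomial.hom_eval₂]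
      conv_rhs => rw [← MvPolynomial.eval₂_eta P0]
      congr 1
      · ext r; simp [Polynomial.algebraMap_apply, MvPolynomial.algebraMap_eq]
      · funext i
        simp only [Polynomial.coe_evalRingHom, Polynomial.eval_add, Polynomial.eval_mul,
          Polynomial.eval_C, Polynomial.eval_X, Y]
        rw [← mul_assoc, ← MvPolynomial.C_mul, mul_one_div]
        ring
    exact this
  have hQ2 : Polynomial.X ^ (mα + m2α) ∣ Q := by
    rw [Polynomial.X_pow_dvd_iff]
    intro j hj
    apply MvPolynomial.funext
    intro z
    rw [map_zero]
    let y : Fin n → ℂ := fun i => z i - α i / a * bil α z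
    have hl : MvPolynomial.eval z (linForm α) = bil α z := by simp [linForm, bil]
    have hy : bil α y = 0 := by
      have : bil α y = bil α z - a / a * bil α z := by
        have h1 : ∀ b t : ℂ, bil α (fun i => z i - α i / b * t) = bil α z - bil α α / b * t := by
          intro b t
          simp only [bil, Finset.sum_div, Finset.sum_mul, ← Finset.sum_sub_distrib]
          exact Finset.sum_congr rfl fun i _ => by ring
        exact h1 a _
      rw [this, div_self hα]; ring
    rw [← key y hy j hj, cf, ← Polynomial.coeff_map]
    congr 1
    rw [← Polynomial.coe_mapRingHom]
    simp only [Q, lineP]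
    rw [MvPolynomial.aeval_def, MvPolynomial.hom_eval₂, MvPolynomial.aeval_def]
    congr 1
    · ext r; simp [Polynomial.algebraMap_apply, MvPolynomial.algebraMap_eq]
    · funext i
      simp [Y, hl, y]
  obtain ⟨R, hR⟩ := hQ2
  rw [← hQ1, hR, Polynomial.eval_mul, Polynomial.eval_pow, Polynomial.eval_X, mul_pow]
  exact Dvd.dvd.mul_right (Dvd.intro_left _ rfl) _
end

section
/- Assume the configuration setup below, and let x ∈ ℂⁿ satisfy sinh⟨γ,x⟩ ≠ 0 for every γ ∈ R₊. If P ∈ ℂ[z₁,…,zₙ] is a nonzero polynomial such that ψ(z) = P(z)·exp⟨z,x⟩ satisfies the quasi-invariance conditions for (R₊, m), then ∏_{γ∈R₊} ⟨γ,z⟩^{m_γ} divides the homogeneous component of P of degree deg P in ℂ[z₁,…,zₙ]. -/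
/-- `ψ` satisfies the quasi-invariance conditions for the configuration
`(R₊, m)` (with derived multiplicities `m₂` for the doubled vectors). -/
def QuasiInv {n : ℕ} (R : Finset (Fin n → ℂ)) (mult mult2 : (Fin n → ℂ) → ℕ)
    (ψ : (Fin n → ℂ) → ℂ) : Prop :=
  ∀ α ∈ R, (2⁻¹ : ℂ) • α ∉ R →
    ∀ s : ℕ,
      ((1 ≤ s ∧ s ≤ mult α) ∨ (∃ t : ℕ, 1 ≤ t ∧ t ≤ mult2 α ∧ s = mult α + 2 * t)) →
      ∀ z : Fin n → ℂ, bil α z = 0 →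
        ψ (z + (s : ℂ) • α) = ψ (z - (s : ℂ) • α)


open Polynomial in
lemma aux_sum_le {r : ℕ} (a : Fin r → ℂ) (ha : Function.Injective a) (k : Fin r → ℕ) (p : ℂ[X])
    (hp : p ≠ 0) (h : ∀ i, (X - C (a i)) ^ k i ∣ p) : ∑ i, k i ≤ p.natDegree := by
  have h1 : ∏ i, (X - C (a i)) ^ k i ∣ p := by
    apply Finset.prod_dvd_of_coprime
    · intro i _ j _ hij
      exact (pairwise_coprime_X_sub_C ha hij).pow
    · intro i _; exact h i
  have h2 := natDegree_le_of_dvd h1 hp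
  rw [natDegree_prod_of_monic _ _ (fun i _ => (monic_X_sub_C _).pow _)] at h2
  simpa using h2

open Polynomial in
lemma aux_dvd_wronskian {d : ℂ} {M : ℕ} {p : ℂ[X]} (q : ℂ[X]) (h : (X - C d) ^ M ∣ p) :
    (X - C d) ^ (M - 1) ∣ wronskian p q := by
  unfold wronskian
  apply dvd_sub
  · exact ((pow_dvd_pow _ (Nat.sub_le _ _)).trans h).mul_right _
  · exact (pow_sub_one_dvd_derivative_of_pow_dvd h).mul_right _

open Polynomial in
lemma aux_dvd_wronskian2 {f p q : ℂ[X]} (hp : f ∣ p) (hq : f ∣ q) :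
    f ^ 2 ∣ wronskian p q := by
  obtain ⟨a, rfl⟩ := hp
  obtain ⟨b, rfl⟩ := hq
  refine ⟨wronskian a b, ?_⟩
  simp only [wronskian, derivative_mul]
  ring

open Polynomial in
lemma aux_wronskian_ne {p q : ℂ[X]} (hp : p ≠ 0) (hq : q ≠ 0) (h : p.natDegree ≠ q.natDegree) :
    wronskian p q ≠ 0 := by
  intro h0
  unfold wronskian at h0
  have h1 := congrArg leadingCoeff (sub_eq_zero.1 h0)
  rw [leadingCoeff_mul, leadingCoeff_mul, leadingCoeff_derivative, leadingCoeff_derivative] at h1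
  have ha := leadingCoeff_ne_zero.2 hp
  have hb := leadingCoeff_ne_zero.2 hq
  have h2 : (q.natDegree : ℂ) = p.natDegree := by
    apply mul_left_cancel₀ (mul_ne_zero ha hb)
    linear_combination h1
  exact h (by exact_mod_cast h2.symm)

open Polynomial in
lemma aux_comp_neg_dvd {d : ℂ} {M : ℕ} {p : ℂ[X]} (h : (X - C d) ^ M ∣ p) :
    (X - C (-d)) ^ M ∣ p.comp (-X) := by
  obtain ⟨a, rfl⟩ := h
  refine ⟨(-1) ^ M * a.comp (-X), ?_⟩
  rw [mul_comp, pow_comp, sub_comp, X_comp, C_comp, ← mul_assoc, ← mul_pow]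
  congr 2
  simp only [map_neg]; ring

open Polynomial in
lemma aux_core0 (g : ℂ[X]) (m : ℕ) (c : ℂ) (hc : c ≠ 0) (hc2 : c ^ 2 ≠ 1)
    (hdeg : g.natDegree ≤ 2 * m) (h1 : g.eval 1 = 0)
    (hd : (X - C c) ^ m ∣ g) (hd' : (X - C c⁻¹) ^ m ∣ g) : g = 0 := by
  by_contra hg
  have hcd : c * c⁻¹ = 1 := mul_inv_cancel₀ hc
  generalize c⁻¹ = d at *
  have := aux_sum_le ![c, d, 1] (by
    intro i j hij
    fin_cases i <;> fin_cases j <;> simp at hij ⊢ <;> grind) ![m, m, 1] g hg (by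
    intro i
    fin_cases i
    · exact hd
    · exact hd'
    · simpa using dvd_iff_isRoot.2 h1)
  simp [Fin.sum_univ_succ] at this
  omega

open Polynomial in
lemma aux_core (g : ℂ[X]) (m l : ℕ) (hm : 1 ≤ m) (c : ℂ) (hc : c ≠ 0) (hc4 : c ^ 4 ≠ 1)
    (hdeg : g.natDegree ≤ 2 * (m + 2 * l))
    (hodd : ∀ k, Odd k → g.coeff k ≠ 0 → 2 * l + 1 ≤ k ∧ k ≤ 2 * l + 2 * m - 1)
    (h1 : g.eval 1 = 0) (h1' : g.eval (-1) = 0)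
    (hd : (X - C c) ^ (m + l) ∣ g) (hd' : (X - C c⁻¹) ^ (m + l) ∣ g) : g = 0 := by
  by_contra hg
  have hcd : c * c⁻¹ = 1 := mul_inv_cancel₀ hc
  have hn := aux_comp_neg_dvd hd
  have hn' := aux_comp_neg_dvd hd'
  generalize c⁻¹ = d at *
  set h := g.comp (-X) with hh
  have hcoeff : ∀ k, h.coeff k = (-1) ^ k * g.coeff k := by
    intro k
    rw [hh, ← neg_one_mul, ← C_1, ← C_neg, comp_C_mul_X_coeff, mul_comm]
  have he : ∀ k, Odd k → (g + h).coeff k = 0 := by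
    intro k hk; rw [coeff_add, hcoeff, hk.neg_one_pow]; ring
  have ho : ∀ k, Even k → (g - h).coeff k = 0 := by
    intro k hk; rw [coeff_sub, hcoeff, hk.neg_one_pow]; ring
  have ho' : ∀ k, (g - h).coeff k ≠ 0 → 2 * l + 1 ≤ k ∧ k ≤ 2 * l + 2 * m - 1 := by
    intro k hk
    have hk1 : Odd k := by
      by_contra hk1
      exact hk (ho k (Nat.not_odd_iff_even.1 hk1))
    apply hodd k hk1
    intro h0
    apply hk
    rw [coeff_sub, hcoeff, h0]; ring
  have hdego : (g - h).natDegree ≤ 2 * l + 2 * m - 1 := by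
    rw [natDegree_le_iff_coeff_eq_zero]
    intro k hk
    by_contra h0
    have := ho' k h0
    omega
  have hXo : X ^ (2 * l + 1) ∣ (g - h) := by
    rw [X_pow_dvd_iff]
    intro k hk
    by_contra h0
    have := ho' k h0
    omega
  have hdegh : h.natDegree = g.natDegree := by
    rw [hh, natDegree_comp]; simp
  have hdege : (g + h).natDegree ≤ 2 * (m + 2 * l) :=
    (natDegree_add_le _ _).trans (by simp [hdegh, hdeg])
  have hW : wronskian (g + h) (g - h) = C (-2) * wronskian g h := by
    simp only [wronskian, derivative_add, derivative_sub, map_neg, map_ofNat]; ring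
  have hw0 : wronskian (g + h) (g - h) = 0 := by
    by_contra hw
    have hlt := natDegree_wronskian_lt_add hw
    have := aux_sum_le ![0, c, d, -c, -d, 1, -1] (by
      intro i j hij
      fin_cases i <;> fin_cases j <;> simp at hij ⊢ <;> grind)
      ![2 * l, m + l - 1, m + l - 1, m + l - 1, m + l - 1, 2, 2] _ hw (by
      intro i
      fin_cases i
      · have : X ^ (2 * l + 1 - 1) ∣ derivative (g - h) := pow_sub_one_dvd_derivative_of_pow_dvd hXo
        simp only [Fin.zero_eta, Matrix.cons_val_zero, map_zero, sub_zero, wronskian]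
        exact dvd_sub (this.mul_left _) (((pow_dvd_pow X (by omega)).trans hXo).mul_left _)
      · rw [hW]; exact (aux_dvd_wronskian _ hd).mul_left _
      · rw [hW]; exact (aux_dvd_wronskian _ hd').mul_left _
      · rw [hW, ← wronskian_neg_eq]; exact ((aux_dvd_wronskian _ hn).neg_right).mul_left _
      · rw [hW, ← wronskian_neg_eq]; exact ((aux_dvd_wronskian _ hn').neg_right).mul_left _
      · apply aux_dvd_wronskian2 <;> rw [dvd_iff_isRoot] <;> simp [hh, h1, h1']
      · apply aux_dvd_wronskian2 <;> rw [dvd_iff_isRoot] <;> simp [hh, h1, h1'])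
    simp [Fin.sum_univ_succ] at this
    omega
  by_cases ho0 : g - h = 0
  · have hgh : g = h := sub_eq_zero.1 ho0
    rw [← hgh] at hn hn'
    have := aux_sum_le ![c, d, -c, -d] (by
      intro i j hij
      fin_cases i <;> fin_cases j <;> simp at hij ⊢ <;> grind)
      ![m + l, m + l, m + l, m + l] _ hg (by
      intro i
      fin_cases i
      · exact hd
      · exact hd'
      · exact hn
      · exact hn')
    simp [Fin.sum_univ_succ] at this
    omega
  by_cases he0 : g + h = 0
  · have hgh : g - h = C 2 * g := by
      have : h = -g := by linear_combination he0
      rw [this, map_ofNat]; ring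
    have hdg : g.natDegree ≤ 2 * l + 2 * m - 1 := by
      rwa [hgh, natDegree_C_mul (by norm_num)] at hdego
    have := aux_sum_le ![c, d] (by
      intro i j hij
      fin_cases i <;> fin_cases j <;> simp at hij ⊢ <;> grind)
      ![m + l, m + l] _ hg (by
      intro i
      fin_cases i
      · exact hd
      · exact hd')
    simp [Fin.sum_univ_succ] at this
    omega
  refine aux_wronskian_ne he0 ho0 ?_ hw0
  intro heq
  have e1 := leadingCoeff_ne_zero.2 he0
  have e2 := leadingCoeff_ne_zero.2 ho0
  unfold leadingCoeff at e1 e2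
  rw [heq] at e1
  rcases Nat.even_or_odd (g - h).natDegree with h' | h'
  · exact e2 (ho _ h')
  · exact e1 (he _ h')

open Polynomial in
lemma aux_mult {M N : ℕ} (s : Fin M → ℕ) (hs : ∀ i, s i ≤ N) (v : Fin M → ℂ) (a b : ℂ)
    (hab : a * b = 1)
    (h : ∀ j < M, ∑ i, v i * (a ^ s i * (s i : ℂ) ^ j - b ^ s i * (-(s i : ℂ)) ^ j) = 0) :
    (X - C a) ^ M ∣ ∑ i, C (v i) * (X ^ (N + s i) - X ^ (N - s i)) := by
  set g : ℂ[X] := ∑ i, C (v i) * (X ^ (N + s i) - X ^ (N - s i)) with hg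
  have hp : ∀ p : ℂ[X], p.natDegree < M →
      ∑ i, v i * (a ^ s i * p.eval (s i : ℂ) - b ^ s i * p.eval (-(s i : ℂ))) = 0 := by
    intro p hpM
    simp only [eval_eq_sum_range' hpM, Finset.mul_sum, ← Finset.sum_sub_distrib]
    rw [Finset.sum_comm]
    apply Finset.sum_eq_zero
    intro j hj
    have := congrArg (p.coeff j * ·) (h j (Finset.mem_range.1 hj))
    simp only [mul_zero, Finset.mul_sum] at this
    rw [← this]
    apply Finset.sum_congr rfl
    intro i _
    ring
  by_cases hg0 : g = 0
  · rw [hg0]; exact dvd_zero _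
  rw [← le_rootMultiplicity_iff hg0]
  rcases Nat.eq_zero_or_pos M with hM | hM
  · omega
  have key : M - 1 < rootMultiplicity a g := by
    rw [lt_rootMultiplicity_iff_isRoot_iterate_derivative hg0]
    intro j hj
    have ha : a ≠ 0 := left_ne_zero_of_mul_eq_one hab
    have hpow : ∀ n : ℕ, a ^ j * ((n.descFactorial j : ℂ) * a ^ (n - j)) =
        (n.descFactorial j : ℂ) * a ^ n := by
      intro n
      rcases lt_or_ge n j with hn | hn
      · simp [Nat.descFactorial_eq_zero_iff_lt.2 hn]
      · have : a ^ n = a ^ (n - j) * a ^ j := by rw [← pow_add, Nat.sub_add_cancel hn]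
        rw [this]; ring
    have h1 := hp ((descPochhammer ℂ j).comp (X + C (N : ℂ))) (by
      rw [natDegree_comp, descPochhammer_natDegree, natDegree_X_add_C]; omega)
    have h2 : a ^ j * ((derivative^[j] g).eval a) = 0 := by
      have h3 := congrArg (a ^ N * ·) h1
      simp only [mul_zero, Finset.mul_sum] at h3
      rw [← h3, hg, iterate_derivative_sum, eval_finsetSum, Finset.mul_sum]
      apply Finset.sum_congr rfl
      intro i _
      rw [iterate_derivative_C_mul, iterate_derivative_sub,
        iterate_derivative_X_pow_eq_natCast_mul, iterate_derivative_X_pow_eq_natCast_mul]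
      simp only [eval_mul, eval_C, eval_sub, eval_natCast, eval_pow, eval_X, eval_comp, eval_add]
      have e1 : (s i : ℂ) + N = ((N + s i : ℕ) : ℂ) := by push_cast; ring
      have e2 : -(s i : ℂ) + N = ((N - s i : ℕ) : ℂ) := by
        rw [Nat.cast_sub (hs i)]; ring
      rw [e1, e2, descPochhammer_eval_eq_descFactorial, descPochhammer_eval_eq_descFactorial]
      have e3 : a ^ N * b ^ s i = a ^ (N - s i) := by
        conv_lhs => rw [← Nat.sub_add_cancel (hs i), pow_add, mul_assoc, ← mul_pow, hab, one_pow]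
        rw [mul_one]
      have q1 := hpow (N + s i)
      have q2 := hpow (N - s i)
      rw [pow_add a N] at q1
      linear_combination v i * q1 - v i * q2 + v i * ((N - s i).descFactorial j : ℂ) * e3
    exact (mul_eq_zero.1 h2).resolve_left (pow_ne_zero _ ha)
  omega

open Polynomial in
lemma aux_one_dim (m l : ℕ) (hm : 1 ≤ m) (c d : ℂ) (hcd : c * d = 1) (hc2 : c ^ 2 ≠ 1)
    (hc4 : 1 ≤ l → c ^ 4 ≠ 1) (F : ℂ[X]) (hF : F.natDegree < m + l)
    (hq : ∀ s : ℕ, ((1 ≤ s ∧ s ≤ m) ∨ (∃ t : ℕ, 1 ≤ t ∧ t ≤ l ∧ s = m + 2 * t)) →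
      c ^ s * F.eval (s : ℂ) = d ^ s * F.eval (-(s : ℂ))) : F = 0 := by
  by_contra hF0
  have hc : c ≠ 0 := left_ne_zero_of_mul_eq_one hcd
  have hdinv : d = c⁻¹ := eq_inv_of_mul_eq_one_right hcd
  let s : Fin (m + l) → ℕ := fun i => if i.1 < m then i.1 + 1 else m + 2 * (i.1 - m + 1)
  have hs : ∀ i, (1 ≤ s i ∧ s i ≤ m) ∨ (∃ t : ℕ, 1 ≤ t ∧ t ≤ l ∧ s i = m + 2 * t) := by
    intro i
    have := i.2
    by_cases h : i.1 < m
    · left; simp only [s, h, if_true]; omega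
    · right; refine ⟨i.1 - m + 1, by omega, by omega, by simp only [s, h, if_false]⟩
  have hsN : ∀ i, s i ≤ m + 2 * l := by
    intro i; rcases hs i with h | ⟨t, h⟩ <;> omega
  have hs1 : ∀ i, 1 ≤ s i := by
    intro i; rcases hs i with h | ⟨t, h⟩ <;> omega
  have hsinj : Function.Injective s := by
    intro i j hij
    apply Fin.ext
    simp only [s] at hij
    split_ifs at hij <;> omega
  let A : Matrix (Fin (m + l)) (Fin (m + l)) ℂ :=
    fun i j => c ^ s i * (s i : ℂ) ^ j.1 - d ^ s i * (-(s i : ℂ)) ^ j.1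
  have hdet : A.det = 0 := by
    rw [← Matrix.exists_mulVec_eq_zero_iff]
    refine ⟨fun j => F.coeff j, ?_, ?_⟩
    · intro h0
      apply hF0
      ext k
      by_cases hk : k < m + l
      · exact congrFun h0 ⟨k, hk⟩
      · exact coeff_eq_zero_of_natDegree_lt (by omega)
    · funext i
      have h := hq (s i) (hs i)
      rw [eval_eq_sum_range' hF, eval_eq_sum_range' hF, Finset.sum_range, Finset.sum_range,
        Finset.mul_sum, Finset.mul_sum, ← sub_eq_zero, ← Finset.sum_sub_distrib] at h
      simp only [Matrix.mulVec, dotProduct, Pi.zero_apply, A]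
      rw [← h]
      apply Finset.sum_congr rfl
      intro j _
      ring
  obtain ⟨v, hv0, hv⟩ := Matrix.exists_vecMul_eq_zero_iff.2 hdet
  have hvj : ∀ j < m + l,
      ∑ i, v i * (c ^ s i * (s i : ℂ) ^ j - d ^ s i * (-(s i : ℂ)) ^ j) = 0 := by
    intro j hj
    exact congrFun hv ⟨j, hj⟩
  have hvj' : ∀ j < m + l,
      ∑ i, v i * (d ^ s i * (s i : ℂ) ^ j - c ^ s i * (-(s i : ℂ)) ^ j) = 0 := by
    intro j hj
    have := congrArg (-(-1) ^ j * ·) (hvj j hj)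
    simp only [mul_zero, Finset.mul_sum] at this
    rw [← this]
    apply Finset.sum_congr rfl
    intro i _
    rw [neg_pow (s i : ℂ)]
    have : ((-1 : ℂ) ^ j) * (-1) ^ j = 1 := by rw [← mul_pow]; simp
    linear_combination (-(v i) * d ^ s i * (s i : ℂ) ^ j) * this
  have D1 := aux_mult (N := m + 2 * l) s hsN v c d hcd hvj
  have D2 := aux_mult (N := m + 2 * l) s hsN v d c (by rw [mul_comm, hcd]) hvj'
  set g : ℂ[X] := ∑ i, C (v i) * (X ^ (m + 2 * l + s i) - X ^ (m + 2 * l - s i)) with hg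
  have hco : ∀ k, g.coeff k = ∑ i, v i * ((if k = m + 2 * l + s i then 1 else 0) -
      (if k = m + 2 * l - s i then 1 else 0)) := by
    intro k
    simp [hg, coeff_X_pow]
  have hne : ∀ k, g.coeff k ≠ 0 → ∃ i, k = m + 2 * l + s i ∨ k = m + 2 * l - s i := by
    intro k hk
    by_contra! hcon
    apply hk
    rw [hco]
    apply Finset.sum_eq_zero
    intro i _
    simp [(hcon i).1, (hcon i).2]
  have hdeg : g.natDegree ≤ 2 * (m + 2 * l) := by
    rw [natDegree_le_iff_coeff_eq_zero]
    intro k hk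
    by_contra h0
    obtain ⟨i, hi⟩ := hne k h0
    have := hsN i
    omega
  have hg0 : g = 0 := by
    have e1 : g.eval 1 = 0 := by simp [hg, eval_finsetSum]
    rw [hdinv] at D2
    rcases Nat.eq_zero_or_pos l with hl | hl
    · subst hl
      exact aux_core0 g m c hc hc2 hdeg e1 D1 D2
    · refine aux_core g m l hm c hc (hc4 hl) hdeg ?_ e1 ?_ D1 D2
      · intro k hk h0
        obtain ⟨i, hi⟩ := hne k h0
        obtain ⟨r, hr⟩ := hk
        have := hsN i
        rcases hs i with h | ⟨t, h⟩ <;> omega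
      · rw [hg, eval_finsetSum]
        apply Finset.sum_eq_zero
        intro i _
        have : (-1 : ℂ) ^ (m + 2 * l + s i) = (-1) ^ (m + 2 * l - s i) := by
          have : m + 2 * l + s i = m + 2 * l - s i + 2 * s i := by have := hsN i; omega
          rw [this, pow_add, pow_mul]; simp
        simp [this]
  apply hv0
  funext i
  have := hco (m + 2 * l + s i)
  rw [hg0, coeff_zero, Finset.sum_eq_single i] at this
  · have h1 := hs1 i
    have h2 := hsN i
    rw [if_pos rfl, if_neg (by omega)] at this
    simpa using this.symm
  · intro j _ hj
    have h1 := hs1 i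
    have h2 : s i ≠ s j := fun h => hj (hsinj h.symm)
    rw [if_neg (by omega), if_neg (by omega)]
    simp
  · simp

lemma aux_smul {n : ℕ} (φ : MvPolynomial (Fin n) ℂ) (j : ℕ) (h : φ.IsHomogeneous j) (c : ℂ)
    (z : Fin n → ℂ) : MvPolynomial.eval (c • z) φ = c ^ j * MvPolynomial.eval z φ := by
  rw [MvPolynomial.eval_eq', MvPolynomial.eval_eq', Finset.mul_sum]
  apply Finset.sum_congr rfl
  intro d hd
  have h1 := h (MvPolynomial.mem_support_iff.1 hd)
  have h2 : ∑ i, d i = j := by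
    rw [← h1, Finsupp.weight_apply, Finsupp.sum_fintype _ _ (by simp)]; simp
  simp only [Pi.smul_apply, smul_eq_mul, mul_pow, Finset.prod_mul_distrib,
    Finset.prod_pow_eq_pow_sum, h2]
  ring

open Polynomial in
lemma aux_map_aeval {σ : Type*} {A : Type*} [CommRing A] [Algebra ℂ A]
    (φ : A →ₐ[ℂ] ℂ) (f : σ → A[X]) (Q : MvPolynomial σ ℂ) :
    (MvPolynomial.aeval f Q).map (φ : A →+* ℂ) = MvPolynomial.aeval (fun i => (f i).map (φ : A →+* ℂ)) Q := by
  exact MvPolynomial.comp_aeval_apply (f := f) (Polynomial.mapAlgHom φ) Q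

open Polynomial in
lemma aux_eval_aeval {σ : Type*} {A : Type*} [CommRing A] [Algebra ℂ A]
    (u : A) (f : σ → A[X]) (Q : MvPolynomial σ ℂ) :
    (MvPolynomial.aeval f Q).eval u = MvPolynomial.aeval (fun i => (f i).eval u) Q := by
  have := MvPolynomial.comp_aeval_apply (f := f) ((Polynomial.aeval u : A[X] →ₐ[A] A).restrictScalars ℂ) Q
  simpa [Polynomial.coe_aeval_eq_eval] using this

lemma aux_eval_linForm {n : ℕ} (α z : Fin n → ℂ) :
    MvPolynomial.eval z (linForm α) = bil α z := by
  simp [linForm, bil]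

open Polynomial in
lemma aux_dvd {n : ℕ} (α : Fin n → ℂ) (hα : bil α α ≠ 0) (M : ℕ) (Q : MvPolynomial (Fin n) ℂ)
    (h : ∀ w : Fin n → ℂ, bil α w = 0 → ∀ k < M,
      (MvPolynomial.aeval (fun i => C (w i) + C (α i) * X) Q : ℂ[X]).coeff k = 0) :
    linForm α ^ M ∣ Q := by
  set W : Fin n → MvPolynomial (Fin n) ℂ :=
    fun i => MvPolynomial.X i - MvPolynomial.C (α i / bil α α) * linForm α with hW
  set Qt : Polynomial (MvPolynomial (Fin n) ℂ) :=
    MvPolynomial.aeval (fun i => C (W i) + C (MvPolynomial.C (α i)) * X) Q with hQt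
  have h1 : Qt.eval (MvPolynomial.C (1 / bil α α) * linForm α) = Q := by
    rw [hQt, aux_eval_aeval]
    conv_rhs => rw [← MvPolynomial.aeval_X_left_apply Q]
    congr 2
    funext i
    simp only [eval_add, eval_mul, eval_C, eval_X, hW]
    rw [← mul_assoc, ← MvPolynomial.C_mul, mul_one_div]
    ring
  have h2 : X ^ M ∣ Qt := by
    rw [X_pow_dvd_iff]
    intro k hk
    apply MvPolynomial.funext
    intro z
    have h3 : MvPolynomial.eval z (Qt.coeff k) =
        (Qt.map ((MvPolynomial.aeval z : MvPolynomial (Fin n) ℂ →ₐ[ℂ] ℂ) :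
          MvPolynomial (Fin n) ℂ →+* ℂ)).coeff k := by
      rw [coeff_map]; simp [MvPolynomial.aeval_eq_eval]
    rw [h3, hQt, aux_map_aeval, map_zero]
    have := h (fun i => z i - α i / bil α α * bil α z) (by
      have e : bil α (fun i => z i - α i / bil α α * bil α z) =
          bil α z - bil α α * (bil α z / bil α α) := by
        conv_lhs => unfold bil
        conv_rhs => enter [1]; unfold bil
        conv_rhs => enter [2, 1]; unfold bil
        rw [Finset.sum_mul, ← Finset.sum_sub_distrib]
        apply Finset.sum_congr rfl
        intro i _
        simp only [bil]
        ring
      rw [e]; field_simp; ring) k hk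
    rw [← this]
    congr 3
    funext i
    simp [hW, MvPolynomial.aeval_eq_eval, aux_eval_linForm]
  rw [← h1]
  obtain ⟨T, hT⟩ := h2
  rw [hT, eval_mul, eval_pow, eval_X, mul_pow]
  exact (Dvd.intro_left _ rfl).mul_right _

open Polynomial in
lemma aux_line {n : ℕ} (α w : Fin n → ℂ) (hw : bil α w = 0) (P : MvPolynomial (Fin n) ℂ)
    (m l : ℕ) (hm : 1 ≤ m) (c d : ℂ) (hcd : c * d = 1) (hc2 : c ^ 2 ≠ 1)
    (hc4 : 1 ≤ l → c ^ 4 ≠ 1)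
    (hq : ∀ s : ℕ, ((1 ≤ s ∧ s ≤ m) ∨ (∃ t : ℕ, 1 ≤ t ∧ t ≤ l ∧ s = m + 2 * t)) →
      ∀ z : Fin n → ℂ, bil α z = 0 →
      c ^ s * MvPolynomial.eval (z + (s : ℂ) • α) P = d ^ s * MvPolynomial.eval (z - (s : ℂ) • α) P)
    (k : ℕ) (hk : k < m + l) :
    (MvPolynomial.aeval (fun i => C (w i) + C (α i) * X)
      (MvPolynomial.homogeneousComponent P.totalDegree P) : ℂ[X]).coeff k = 0 := by
  set D := P.totalDegree with hD
  set p : ℕ → ℂ[X] := fun j => MvPolynomial.aeval (fun i => C (w i) + C (α i) * X)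
      (MvPolynomial.homogeneousComponent j P) with hp
  change (p D).coeff k = 0
  have hpdeg : ∀ j, (p j).natDegree ≤ j := by
    intro j
    have := MvPolynomial.aeval_natDegree_le (MvPolynomial.homogeneousComponent j P)
      (MvPolynomial.homogeneousComponent_isHomogeneous j P).totalDegree_le
      (fun i => C (w i) + C (α i) * X) (n := 1) (fun i => by compute_degree)
    simpa using this
  rcases lt_or_ge D k with hDk | hkD
  · exact coeff_eq_zero_of_natDegree_lt ((hpdeg D).trans_lt hDk)
  let F : ℕ → ℂ[X] := fun e => ∑ r ∈ Finset.range (D + 1 - e), C ((p (e + r)).coeff r) * X ^ r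
  let B : ℂ → ℂ[X] := fun t => ∑ e ∈ Finset.range (D + 1), C ((F e).eval t) * X ^ e
  have hBcoeff : ∀ t e, e ≤ D → (B t).coeff e = (F e).eval t := by
    intro t e he
    simp only [B, finsetSum_coeff, coeff_C_mul, coeff_X_pow]
    rw [Finset.sum_eq_single e]
    · simp
    · intro b _ hb; rw [if_neg (Ne.symm hb), mul_zero]
    · intro h; exact absurd (Finset.mem_range.2 (by omega)) h
  have hBeval : ∀ t lam : ℂ, lam ≠ 0 →
      MvPolynomial.eval (lam • w + t • α) P = (B t).eval lam := by
    intro t lam hl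
    have hpe : ∀ j, MvPolynomial.eval (lam • w + t • α) (MvPolynomial.homogeneousComponent j P) =
        ∑ e ∈ Finset.range (j + 1), (p (e + (j - e))).coeff (j - e) * t ^ (j - e) * lam ^ e := by
      intro j
      have e1 : lam • w + t • α = lam • (w + (t / lam) • α) := by
        rw [smul_add, smul_smul, mul_div_cancel₀ _ hl]
      have e2 : MvPolynomial.eval (w + (t / lam) • α) (MvPolynomial.homogeneousComponent j P) =
          (p j).eval (t / lam) := by
        rw [hp, aux_eval_aeval, MvPolynomial.aeval_eq_eval]
        congr 2
        funext i
        simp; ring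
      have e3 : MvPolynomial.eval (lam • (w + (t / lam) • α))
          (MvPolynomial.homogeneousComponent j P) = lam ^ j *
          MvPolynomial.eval (w + (t / lam) • α) (MvPolynomial.homogeneousComponent j P) := by
        exact aux_smul _ _ (MvPolynomial.homogeneousComponent_isHomogeneous j P) _ _
      rw [e1, e3, e2, eval_eq_sum_range' (Nat.lt_succ_of_le (hpdeg j)), Finset.mul_sum,
        ← Finset.sum_flip]
      apply Finset.sum_congr rfl
      intro e he
      have he' : e ≤ j := by have := Finset.mem_range.1 he; omega
      rw [Nat.add_sub_cancel' he', div_pow]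
      have : lam ^ j = lam ^ (j - e) * lam ^ e := by rw [← pow_add, Nat.sub_add_cancel he']
      rw [this]
      field_simp
    conv_lhs => rw [← MvPolynomial.sum_homogeneousComponent P]
    rw [map_sum]
    simp only [hpe]
    rw [Finset.sum_range_diag_flip (D + 1) (fun e r => (p (e + r)).coeff r * t ^ r * lam ^ e)]
    simp only [B, F, eval_finsetSum, eval_mul, eval_C, eval_pow, eval_X, Finset.sum_mul]
  have hF : F (D - k) = 0 := by
    apply aux_one_dim m l hm c d hcd hc2 hc4
    · refine lt_of_le_of_lt ?_ hk
      apply natDegree_sum_le_of_forall_le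
      intro r hr
      have := Finset.mem_range.1 hr
      exact (natDegree_C_mul_X_pow_le _ _).trans (by omega)
    · intro s hs
      have hB : C (c ^ s) * B s = C (d ^ s) * B (-s) := by
        apply eq_of_infinite_eval_eq
        apply Set.Infinite.mono (s := {0}ᶜ)
        · intro lam hlam
          have hl : lam ≠ 0 := hlam
          have hz : bil α (lam • w) = 0 := by
            have : bil α (lam • w) = lam * bil α w := by
              simp only [bil, Finset.mul_sum, Pi.smul_apply, smul_eq_mul]
              exact Finset.sum_congr rfl (fun i _ => by ring)
            rw [this, hw, mul_zero]
          have := hq s hs (lam • w) hz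
          rw [sub_eq_add_neg, ← neg_smul, hBeval _ _ hl, hBeval _ _ hl] at this
          simpa using this
        · exact (Set.finite_singleton _).infinite_compl
      have := congrArg (fun q => q.coeff (D - k)) hB
      simp only [coeff_C_mul] at this
      rwa [hBcoeff _ _ (by omega), hBcoeff _ _ (by omega)] at this
  have := congrArg (fun q => q.coeff k) hF
  simp only [F, finsetSum_coeff, coeff_C_mul, coeff_X_pow, coeff_zero] at this
  rw [Finset.sum_eq_single k] at this
  · simpa [Nat.sub_add_cancel hkD] using this
  · intro b _ hb; rw [if_neg (Ne.symm hb), mul_zero]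
  · intro h; exact absurd (Finset.mem_range.2 (by omega)) h

lemma aux_linForm_smul {n : ℕ} (c : ℂ) (α : Fin n → ℂ) :
    linForm (c • α) = MvPolynomial.C c * linForm α := by
  simp only [linForm, Finset.mul_sum, Pi.smul_apply, smul_eq_mul, MvPolynomial.C_mul, mul_assoc]

lemma aux_linForm_homog {n : ℕ} (α : Fin n → ℂ) : (linForm α).IsHomogeneous 1 := by
  unfold linForm
  apply MvPolynomial.IsHomogeneous.sum
  intro i _
  simpa using (MvPolynomial.isHomogeneous_C (Fin n) (α i)).mul (MvPolynomial.isHomogeneous_X ℂ i)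

lemma aux_linForm_ne {n : ℕ} (α : Fin n → ℂ) (hα : bil α α ≠ 0) : linForm α ≠ 0 := by
  intro h
  apply hα
  rw [← aux_eval_linForm, h, map_zero]

lemma aux_linForm_irred {n : ℕ} (α : Fin n → ℂ) (hα : bil α α ≠ 0) : Irreducible (linForm α) := by
  apply MvPolynomial.irreducible_of_totalDegree_eq_one
  · exact (aux_linForm_homog α).totalDegree (aux_linForm_ne α hα)
  · intro x hx
    rw [isUnit_iff_ne_zero]
    rintro rfl
    apply aux_linForm_ne α hα
    ext i
    simpa using hx i

lemma aux_linForm_coeff {n : ℕ} (α : Fin n → ℂ) (i : Fin n) :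
    MvPolynomial.eval (Pi.single i 1) (linForm α) = α i := by
  rw [aux_eval_linForm]
  simp [bil, Pi.single_apply]

lemma aux_relPrime {n : ℕ} (α β : Fin n → ℂ) (hα : bil α α ≠ 0) (hβ : bil β β ≠ 0)
    (h : ¬ ∃ c : ℂ, β = c • α) : IsRelPrime (linForm α) (linForm β) := by
  rw [(aux_linForm_irred α hα).isRelPrime_iff_not_dvd]
  intro hd
  have ha := (aux_linForm_irred α hα).associated_of_dvd (aux_linForm_irred β hβ) hd
  obtain ⟨u, hu⟩ := ha
  obtain ⟨c, _, hc⟩ := MvPolynomial.isUnit_iff_eq_C_of_isReduced.1 u.isUnit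
  apply h
  refine ⟨c, ?_⟩
  funext i
  rw [← aux_linForm_coeff β i, ← hu, hc, map_mul, aux_linForm_coeff]
  simp [mul_comm]

lemma aux_key {n : ℕ} (R : Finset (Fin n → ℂ))
    (hR0 : ∀ γ ∈ R, bil γ γ ≠ 0)
    (mult mult2 : (Fin n → ℂ) → ℕ)
    (hmult : ∀ α ∈ R, (2⁻¹ : ℂ) • α ∉ R → 1 ≤ mult α)
    (hmult2 : ∀ α : Fin n → ℂ,
      ((2 : ℂ) • α ∈ R → mult2 α = mult ((2 : ℂ) • α)) ∧
      ((2 : ℂ) • α ∉ R → mult2 α = 0))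
    (x : Fin n → ℂ) (hx : ∀ γ ∈ R, Complex.sinh (bil γ x) ≠ 0)
    (P : MvPolynomial (Fin n) ℂ)
    (hquasi : QuasiInv R mult mult2
      (fun z => MvPolynomial.eval z P * Complex.exp (bil z x)))
    (α : Fin n → ℂ) (hα : α ∈ R) (hα2 : (2⁻¹ : ℂ) • α ∉ R) :
    linForm α ^ (mult α + mult2 α) ∣ MvPolynomial.homogeneousComponent P.totalDegree P := by
  apply aux_dvd α (hR0 α hα)
  intro w hw k hk
  have hsinh : ∀ a : ℂ, Complex.sinh a ≠ 0 → Complex.exp a ^ 2 ≠ 1 := by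
    intro a ha h
    apply ha
    have h2 : Complex.exp a * Complex.exp (-a) = 1 := by rw [← Complex.exp_add]; simp
    have h3 : Complex.exp a = Complex.exp (-a) := by
      apply mul_left_cancel₀ (Complex.exp_ne_zero a)
      rw [h2, ← h]; ring
    rw [Complex.sinh, h3]; simp
  have hbil : ∀ (c : ℂ) (z : Fin n → ℂ), bil (z + c • α) x = bil z x + c * bil α x := by
    intro c z
    simp only [bil, Finset.mul_sum, ← Finset.sum_add_distrib, Pi.add_apply, Pi.smul_apply,
      smul_eq_mul]
    exact Finset.sum_congr rfl (fun i _ => by ring)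
  refine aux_line α w hw P (mult α) (mult2 α) (hmult α hα hα2)
    (Complex.exp (bil α x)) (Complex.exp (-bil α x)) (by rw [← Complex.exp_add]; simp)
    (hsinh _ (hx α hα)) ?_ ?_ k hk
  · intro hl
    have h2 : (2 : ℂ) • α ∈ R := by
      by_contra hn
      have := (hmult2 α).2 hn
      omega
    have h3 := hsinh _ (hx _ h2)
    have h4 : bil ((2 : ℂ) • α) x = bil α x + bil α x := by
      simp only [bil, ← Finset.sum_add_distrib, Pi.smul_apply, smul_eq_mul]
      exact Finset.sum_congr rfl (fun i _ => by ring)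
    rw [h4, Complex.exp_add] at h3
    intro h5
    apply h3
    rw [← h5]; ring
  · intro s hs z hz
    have h := hquasi α hα hα2 s hs z hz
    simp only at h
    rw [sub_eq_add_neg, ← neg_smul, hbil, hbil, Complex.exp_add, Complex.exp_add,
      Complex.exp_nat_mul] at h
    rw [neg_mul, ← mul_neg, Complex.exp_nat_mul] at h
    rw [sub_eq_add_neg, ← neg_smul]
    apply mul_left_cancel₀ (Complex.exp_ne_zero (bil z x))
    linear_combination h


/-- For a quasi-invariant `ψ(z) = P(z)·exp⟨z,x⟩`, the product
`∏_{γ∈R₊} ⟨γ,z⟩^{m_γ}` divides the top homogeneous component of `P`. -/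
theorem stmt_3 (n : ℕ) (hn : 1 ≤ n)
    (R : Finset (Fin n → ℂ))
    (hR0 : ∀ γ ∈ R, bil γ γ ≠ 0)
    (hRcol : ∀ γ ∈ R, ∀ δ ∈ R, γ ≠ δ → (∃ c : ℂ, δ = c • γ) →
      δ = (2 : ℂ) • γ ∨ γ = (2 : ℂ) • δ)
    (mult mult2 : (Fin n → ℂ) → ℕ)
    (hmult : ∀ α ∈ R, (2⁻¹ : ℂ) • α ∉ R → 1 ≤ mult α)
    (hmult2 : ∀ α : Fin n → ℂ,
      ((2 : ℂ) • α ∈ R → mult2 α = mult ((2 : ℂ) • α)) ∧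
      ((2 : ℂ) • α ∉ R → mult2 α = 0))
    (x : Fin n → ℂ) (hx : ∀ γ ∈ R, Complex.sinh (bil γ x) ≠ 0)
    (P : MvPolynomial (Fin n) ℂ) (hP : P ≠ 0)
    (hquasi : QuasiInv R mult mult2
      (fun z => MvPolynomial.eval z P * Complex.exp (bil z x))) :
    (∏ γ ∈ R, linForm γ ^ mult γ) ∣
      MvPolynomial.homogeneousComponent P.totalDegree P := by
  classical
  set Q := MvPolynomial.homogeneousComponent P.totalDegree P with hQ
  have hne : ∀ γ ∈ R, ∀ c : ℂ, c • γ = γ → c = 1 := by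
    intro γ hγ c hc
    by_contra hc1
    apply hR0 γ hγ
    have h0 : γ = 0 := by
      have : (c - 1) • γ = 0 := by rw [sub_smul, hc, one_smul, sub_self]
      exact (smul_eq_zero.1 this).resolve_left (sub_ne_zero.2 hc1)
    simp [h0, bil]
  set Rr := R.filter (fun α => (2⁻¹ : ℂ) • α ∉ R) with hRr
  have hprod : ∏ γ ∈ R, linForm γ ^ mult γ =
      ∏ α ∈ Rr, (linForm α ^ mult α *
        (if (2 : ℂ) • α ∈ R then linForm ((2 : ℂ) • α) ^ mult ((2 : ℂ) • α) else 1)) := by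
    rw [Finset.prod_mul_distrib, ← Finset.prod_filter_mul_prod_filter_not R
      (fun α => (2⁻¹ : ℂ) • α ∉ R), ← Finset.prod_filter]
    congr 1
    symm
    refine Finset.prod_bij (fun α _ => (2 : ℂ) • α) ?_ ?_ ?_ ?_
    · intro α h
      simp only [hRr, Finset.mem_filter] at h ⊢
      refine ⟨h.2, ?_⟩
      rw [smul_smul]
      simpa using h.1.1
    · intro a _ b _ hab
      exact smul_right_injective _ (two_ne_zero) hab
    · intro β hβ
      simp only [Finset.mem_filter, not_not] at hβ
      have hb : (2 : ℂ) • (2⁻¹ : ℂ) • β = β := by rw [smul_smul]; simp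
      refine ⟨(2⁻¹ : ℂ) • β, ?_, hb⟩
      simp only [hRr, Finset.mem_filter]
      refine ⟨⟨hβ.2, ?_⟩, by rw [hb]; exact hβ.1⟩
      intro h4
      rw [smul_smul] at h4
      have hne4 : β ≠ (2⁻¹ * 2⁻¹ : ℂ) • β := by
        intro h
        have := hne β hβ.1 _ h.symm
        norm_num at this
      rcases hRcol β hβ.1 _ h4 hne4 ⟨_, rfl⟩ with h | h
      · have h' := congrArg ((2⁻¹ : ℂ) • ·) h
        simp only [smul_smul] at h'
        have := hne β hβ.1 (2⁻¹ * (2⁻¹ * 2⁻¹)) (by rw [h']; norm_num)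
        norm_num at this
      · rw [smul_smul] at h
        have := hne β hβ.1 _ h.symm
        norm_num at this
    · intro α _
      rfl
  have hassoc : ∀ α, Associated (linForm α ^ (mult α + mult2 α)) (linForm α ^ mult α *
        (if (2 : ℂ) • α ∈ R then linForm ((2 : ℂ) • α) ^ mult ((2 : ℂ) • α) else 1)) := by
    intro α
    rw [pow_add]
    apply Associated.mul_left
    split_ifs with h
    · rw [(hmult2 α).1 h]
      apply Associated.pow_pow
      rw [aux_linForm_smul]
      exact (associated_unit_mul_left _ _
        ((isUnit_iff_ne_zero.2 (two_ne_zero : (2 : ℂ) ≠ 0)).map MvPolynomial.C)).symm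
    · rw [(hmult2 α).2 h, pow_zero]
  rw [hprod]
  rw [← (Associated.prod Rr _ _ (fun α _ => hassoc α)).dvd_iff_dvd_left]
  apply Finset.prod_dvd_of_isRelPrime
  · intro α hα β hβ hαβ
    have hα' := Finset.mem_filter.1 hα
    have hβ' := Finset.mem_filter.1 hβ
    apply IsRelPrime.pow
    apply aux_relPrime α β (hR0 α hα'.1) (hR0 β hβ'.1)
    intro hc
    rcases hRcol α hα'.1 β hβ'.1 hαβ hc with h | h
    · apply hβ'.2
      rw [h, smul_smul]
      simpa using hα'.1
    · apply hα'.2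
      rw [h, smul_smul]
      simpa using hβ'.1
  · intro α hα
    have hα' := Finset.mem_filter.1 hα
    exact aux_key R hR0 mult mult2 hmult hmult2 x hx P hquasi α hα'.1 hα'.2
end
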